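/- arXiv:1512.04188 — 9 statements merged into one kernel-verified Lean document; each statement's English description precedes it below -/
import Mathlib

section
/- Let n ≥ 100 be an integer and let t be a real number with 4 ≤ t ≤ n²/(2n−1). Then every n-uniform hypergraph with at most n²/t vertices and at most 2^{n−1}·exp(t/8) hyperedges is two-colorable. -/
/-- Halving step by step: a fixed `k`-set is avoided by a random half of a `2m`-set with
probability at most `2⁻ᵏ exp (-k(k-1)/(4m))`. -/
theorem two_pow_mul_choose_le (m : ℕ) (hm : 0 < m) (k : ℕ) :
    (2 : ℝ) ^ k * ((2 * m - k).choose m : ℝ) ≤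
      ((2 * m).choose m : ℝ) * Real.exp (-((k : ℝ) * (k - 1) / (4 * m))) := by
  have hm' : (0 : ℝ) < m := by exact_mod_cast hm
  induction k with
  | zero => simp
  | succ k ih =>
    rcases Nat.lt_or_ge k m with hk | hk
    · have hk' : (k : ℝ) < m := by exact_mod_cast hk
      have hkk : (0 : ℝ) ≤ k := Nat.cast_nonneg k
      have hrec : ((2 * m - (k + 1)).choose m : ℝ) * (2 * m - k)
          = ((2 * m - k).choose m : ℝ) * (m - k) := by
        have h := Nat.choose_mul_succ_eq (2 * m - (k + 1)) m
        rw [show 2 * m - (k + 1) + 1 = 2 * m - k by omega,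
          show 2 * m - k - m = m - k by omega] at h
        have h' : (((2 * m - (k + 1)).choose m * (2 * m - k) : ℕ) : ℝ)
            = (((2 * m - k).choose m * (m - k) : ℕ) : ℝ) := by rw [h]
        rw [Nat.cast_mul, Nat.cast_mul, Nat.cast_sub (by omega), Nat.cast_sub (by omega)] at h'
        push_cast at h'
        exact h'
      have hden : (0 : ℝ) < 2 * m - k := by linarith
      have hstep : 2 * ((2 * m - (k + 1)).choose m : ℝ)
          ≤ ((2 * m - k).choose m : ℝ) * Real.exp (-(k / (2 * m))) := by
        have hexp : 1 - (k : ℝ) / (2 * m) ≤ Real.exp (-(k / (2 * m))) := by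
          have := Real.add_one_le_exp (-((k : ℝ) / (2 * m)))
          linarith
        have hfrac : 2 * ((m : ℝ) - k) / (2 * m - k) ≤ 1 - (k : ℝ) / (2 * m) := by
          rw [div_le_iff₀ hden]
          have : (1 - (k : ℝ) / (2 * m)) * (2 * m - k) = 2 * (m - k) + k ^ 2 / (2 * m) := by
            field_simp
            ring
          rw [this]
          have : 0 ≤ (k : ℝ) ^ 2 / (2 * m) := by positivity
          linarith
        calc 2 * ((2 * m - (k + 1)).choose m : ℝ)
            = ((2 * m - k).choose m : ℝ) * (2 * ((m : ℝ) - k) / (2 * m - k)) := by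
              field_simp
              linarith
          _ ≤ _ := by
              gcongr
              exact hfrac.trans hexp
      calc (2 : ℝ) ^ (k + 1) * ((2 * m - (k + 1)).choose m : ℝ)
          = 2 ^ k * (2 * ((2 * m - (k + 1)).choose m : ℝ)) := by ring
        _ ≤ 2 ^ k * (((2 * m - k).choose m : ℝ) * Real.exp (-(k / (2 * m)))) := by gcongr
        _ = (2 ^ k * ((2 * m - k).choose m : ℝ)) * Real.exp (-(k / (2 * m))) := by ring
        _ ≤ (((2 * m).choose m : ℝ) * Real.exp (-((k : ℝ) * (k - 1) / (4 * m))))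
              * Real.exp (-(k / (2 * m))) := by gcongr
        _ = _ := by
          rw [mul_assoc, ← Real.exp_add]
          congr 2
          push_cast
          field_simp
          ring
    · rw [Nat.choose_eq_zero_of_lt (by omega : 2 * m - (k + 1) < m)]
      simp only [Nat.cast_zero, mul_zero]
      positivity

/-- Union bound over the balanced colorings of a set of `2m` vertices. -/
theorem exists_balanced_set_of_card_mul_lt {α : Type*} [Fintype α] [DecidableEq α] (m n : ℕ)
    (hα : Fintype.card α = 2 * m) (E : Finset (Finset α)) (huniform : ∀ e ∈ E, e.card = n)
    (hE : E.card * (2 * (2 * m - n).choose m) < (2 * m).choose m) :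
    ∃ S : Finset α, ∀ e ∈ E, (∃ x ∈ e, x ∈ S) ∧ ∃ y ∈ e, y ∉ S := by
  let bad : Finset α → Finset (Finset α) := fun e =>
    Finset.powersetCard m eᶜ ∪ (Finset.powersetCard m eᶜ).image compl
  have hbad : (E.biUnion bad).card < (Finset.powersetCard m (Finset.univ : Finset α)).card := by
    rw [Finset.card_powersetCard, Finset.card_univ, hα]
    refine lt_of_le_of_lt (Finset.card_biUnion_le_card_mul _ _ _ fun e he => ?_) hE
    have hcard : (Finset.powersetCard m eᶜ).card = (2 * m - n).choose m := by
      rw [Finset.card_powersetCard, Finset.card_compl, hα, huniform e he]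
    calc (bad e).card
        ≤ (Finset.powersetCard m eᶜ).card + ((Finset.powersetCard m eᶜ).image compl).card :=
          Finset.card_union_le _ _
      _ ≤ (Finset.powersetCard m eᶜ).card + (Finset.powersetCard m eᶜ).card := by
          exact Nat.add_le_add_left Finset.card_image_le _
      _ = 2 * (2 * m - n).choose m := by rw [hcard]; ring
  obtain ⟨S, hS, hSbad⟩ := Finset.exists_mem_notMem_of_card_lt_card hbad
  have hScard : S.card = m := (Finset.mem_powersetCard.1 hS).2
  refine ⟨S, fun e he => ⟨?_, ?_⟩⟩ <;> by_contra! hcon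
  · refine hSbad (Finset.mem_biUnion.2 ⟨e, he, Finset.mem_union_left _ ?_⟩)
    refine Finset.mem_powersetCard.2 ⟨fun x hx => ?_, hScard⟩
    exact Finset.mem_compl.2 fun hxe => hcon x hxe hx
  · refine hSbad (Finset.mem_biUnion.2 ⟨e, he, Finset.mem_union_right _ ?_⟩)
    refine Finset.mem_image.2 ⟨Sᶜ, Finset.mem_powersetCard.2 ⟨?_, ?_⟩, compl_compl S⟩
    · exact Finset.compl_subset_compl.2 hcon
    · rw [Finset.card_compl, hα, hScard]
      omega


/-- **Theorem 1(a) / Theorem 8 (paper)**: For `n ≥ 100` and `4 ≤ t ≤ n²/(2n-1)`,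
every `n`-uniform hypergraph with at most `n²/t` vertices and at most
`2^(n-1) * exp(t/8)` hyperedges is two-colorable. -/
theorem two_colorable_of_few_vertices
    (n : ℕ) (hn : 100 ≤ n) (t : ℝ) (ht4 : 4 ≤ t)
    (ht : t ≤ (n : ℝ) ^ 2 / (2 * (n : ℝ) - 1))
    (v : ℕ) (hv : (v : ℝ) ≤ (n : ℝ) ^ 2 / t)
    (E : Finset (Finset (Fin v)))
    (huniform : ∀ e ∈ E, e.card = n)
    (hE : (E.card : ℝ) ≤ 2 ^ (n - 1) * Real.exp (t / 8)) :
    ∃ χ : Fin v → Bool, ∀ e ∈ E, ∃ x ∈ e, ∃ y ∈ e, χ x ≠ χ y := by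
  have hn' : (100 : ℝ) ≤ n := by exact_mod_cast hn
  have htn : t ≤ n := by
    refine ht.trans ((div_le_iff₀ (by linarith)).2 ?_)
    nlinarith
  obtain ⟨m, hm, hvm, hmv⟩ : ∃ m, 0 < m ∧ v ≤ 2 * m ∧ 2 * m ≤ v + 2 :=
    ⟨v / 2 + 1, by omega, by omega, by omega⟩
  have hm' : (0 : ℝ) < m := by exact_mod_cast hm
  have hmv' : 2 * (m : ℝ) ≤ v + 2 := by exact_mod_cast hmv
  have hlt : t / 8 < (n : ℝ) * (n - 1) / (4 * m) := by
    have hvt : (v : ℝ) * t ≤ n ^ 2 := (le_div_iff₀ (by linarith)).1 hv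
    have hmt : 2 * (m : ℝ) * t ≤ n ^ 2 + 2 * n := by nlinarith
    rw [lt_div_iff₀ (by linarith)]
    nlinarith
  have hcount : E.card * (2 * (2 * m - n).choose m) < (2 * m).choose m := by
    have hC : (0 : ℝ) < ((2 * m).choose m : ℝ) := by
      exact_mod_cast Nat.choose_pos (by omega)
    have hreal : (E.card : ℝ) * (2 * ((2 * m - n).choose m : ℝ)) < ((2 * m).choose m : ℝ) := by
      calc (E.card : ℝ) * (2 * ((2 * m - n).choose m : ℝ))
          ≤ (2 ^ (n - 1) * Real.exp (t / 8)) * (2 * ((2 * m - n).choose m : ℝ)) := by gcongr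
        _ = Real.exp (t / 8) * (2 ^ n * ((2 * m - n).choose m : ℝ)) := by
            rw [← pow_sub_one_mul (by omega : n ≠ 0) (2 : ℝ)]
            ring
        _ ≤ Real.exp (t / 8) *
              (((2 * m).choose m : ℝ) * Real.exp (-((n : ℝ) * (n - 1) / (4 * m)))) := by
            exact mul_le_mul_of_nonneg_left (two_pow_mul_choose_le m hm n) (Real.exp_pos _).le
        _ = ((2 * m).choose m : ℝ) * Real.exp (t / 8 - (n : ℝ) * (n - 1) / (4 * m)) := by
            rw [sub_eq_add_neg (t / 8), Real.exp_add]
            ring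
        _ < ((2 * m).choose m : ℝ) :=
            mul_lt_of_lt_one_right hC (Real.exp_lt_one_iff.2 (by linarith))
    exact_mod_cast hreal
  let f : Fin v ↪ Fin (2 * m) := Fin.castLEEmb hvm
  obtain ⟨S, hS⟩ := exists_balanced_set_of_card_mul_lt m n (Fintype.card_fin _)
    (E.image (Finset.map f))
    (by
      intro e he
      obtain ⟨e', he', rfl⟩ := Finset.mem_image.1 he
      rw [Finset.card_map, huniform e' he'])
    (lt_of_le_of_lt (Nat.mul_le_mul_right _ Finset.card_image_le) hcount)
  refine ⟨fun x => decide (f x ∈ S), fun e he => ?_⟩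
  obtain ⟨⟨x, hx, hxS⟩, y, hy, hyS⟩ := hS _ (Finset.mem_image_of_mem _ he)
  obtain ⟨x, hxe, rfl⟩ := Finset.mem_map.1 hx
  obtain ⟨y, hye, rfl⟩ := Finset.mem_map.1 hy
  exact ⟨x, hxe, y, hye, by simp [hxS, hyS]⟩
end

section
/- Let n ≥ 2 be an integer, let t ≥ 4 be a real number, and let H be an n-uniform hypergraph on the vertex set [v] with v ≤ n²/t vertices and q hyperedges. Then the number of balanced two-colorings of [v] that leave some hyperedge of H monochromatic is at most 2^{−(n−1)}·exp(−t/8)·q·C(v,⌈v/2⌉); equivalently, a uniformly random balanced two-coloring of [v] is valid for H with probability at least 1 − 2^{−(n−1)}·exp(−t/8)·q. -/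
/-- Subset-of-a-subset identity: choosing `n` and then `m` disjoint elements of a `v`-set
can be done in either order. -/
lemma choose_sub_mul_descFactorial (v n m : ℕ) :
    (v - n).choose m * v.descFactorial n = v.choose m * (v - m).descFactorial n := by
  simp only [Nat.descFactorial_eq_factorial_mul_choose]
  have h1 := Nat.choose_mul (n := v) (k := n + m) (s := n) (Nat.le_add_right n m)
  have h2 := Nat.choose_mul (n := v) (k := n + m) (s := m) (Nat.le_add_left m n)
  rw [Nat.add_sub_cancel_left] at h1
  rw [Nat.add_sub_cancel, ← Nat.choose_symm_add, h1] at h2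
  linear_combination n.factorial * h2

lemma two_mul_sub_le_mul_exp {k j : ℕ} {v : ℝ} (hv : 0 < v) (hk : 2 * (k : ℝ) ≤ v) :
    2 * ((k - j : ℕ) : ℝ) ≤ ((2 * k - j : ℕ) : ℝ) * Real.exp (-(j / v)) := by
  rcases le_total k j with h | h
  · rw [Nat.sub_eq_zero_of_le h, Nat.cast_zero, mul_zero]
    positivity
  · have h' : (j : ℝ) ≤ k := by exact_mod_cast h
    have hj : (0 : ℝ) ≤ j := j.cast_nonneg
    rw [Nat.cast_sub h, Nat.cast_sub (by omega : j ≤ 2 * k)]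
    push_cast
    have h1 : (2 * (k : ℝ) - j) * (j / v) ≤ j := by
      rw [mul_div_assoc', div_le_iff₀ hv]
      nlinarith
    have h2 := mul_le_mul_of_nonneg_left (Real.one_sub_le_exp_neg ((j : ℝ) / v))
      (by linarith : (0 : ℝ) ≤ 2 * (k : ℝ) - j)
    linarith

lemma two_pow_mul_descFactorial_le {v : ℝ} (hv : 0 < v) {k : ℕ} (hk : 2 * (k : ℝ) ≤ v) (n : ℕ) :
    (2 : ℝ) ^ n * k.descFactorial n ≤
      (2 * k).descFactorial n * Real.exp (-(n * (n - 1) / (2 * v))) := by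
  induction n with
  | zero => simp
  | succ j ih =>
    have h := mul_le_mul (two_mul_sub_le_mul_exp (j := j) hv hk) ih (by positivity) (by positivity)
    have hexp : Real.exp (-(((j + 1 : ℕ) : ℝ) * ((j + 1 : ℕ) - 1) / (2 * v))) =
        Real.exp (-(j / v)) * Real.exp (-(j * (j - 1) / (2 * v))) := by
      rw [← Real.exp_add]
      congr 1
      push_cast
      field_simp
      ring
    rw [hexp, Nat.descFactorial_succ, Nat.descFactorial_succ, pow_succ]
    push_cast
    linarith

lemma two_pow_mul_descFactorial_add_le {v n : ℕ} (hv : 0 < v) (hn : 0 < n) :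
    (2 : ℝ) ^ (n - 1) *
        (((v + 1) / 2).descFactorial n + (v - (v + 1) / 2).descFactorial n : ℕ) ≤
      v.descFactorial n * Real.exp (-(n * (n - 1) / (2 * v))) := by
  have hv' : (0 : ℝ) < v := by exact_mod_cast hv
  obtain ⟨j, rfl⟩ : ∃ j, n = j + 1 := ⟨n - 1, by omega⟩
  rcases Nat.even_or_odd' v with ⟨k, rfl | rfl⟩
  · have h := two_pow_mul_descFactorial_le hv' (k := k) (by push_cast; rfl) (j + 1)
    rw [show (2 * k + 1) / 2 = k by omega, show 2 * k - k = k by omega, Nat.add_sub_cancel]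
    rw [pow_succ] at h
    push_cast at h ⊢
    linarith
  · have h := two_pow_mul_descFactorial_le hv' (k := k) (by push_cast; linarith) j
    rw [show (2 * k + 1 + 1) / 2 = k + 1 by omega, show 2 * k + 1 - (k + 1) = k by omega,
      Nat.add_sub_cancel, Nat.succ_descFactorial_succ, Nat.succ_descFactorial_succ,
      Nat.descFactorial_succ, ← add_mul]
    rcases lt_or_ge k j with hkj | hkj
    · rw [Nat.descFactorial_eq_zero_iff_lt.2 hkj, mul_zero, Nat.cast_zero, mul_zero]
      positivity
    · have hfac : ((k + 1 + (k - j) : ℕ) : ℝ) ≤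
          ((2 * k + 1 : ℕ) : ℝ) * Real.exp (-(j / ((2 * k + 1 : ℕ) : ℝ))) := by
        have h1 := mul_le_mul_of_nonneg_left
          (Real.one_sub_le_exp_neg ((j : ℝ) / ((2 * k + 1 : ℕ) : ℝ))) hv'.le
        rw [mul_sub, mul_div_cancel₀ _ hv'.ne'] at h1
        refine le_trans (le_of_eq ?_) h1
        push_cast [Nat.cast_sub hkj]
        ring
      have hexp : Real.exp
          (-(((j + 1 : ℕ) : ℝ) * ((j + 1 : ℕ) - 1) / (2 * ((2 * k + 1 : ℕ) : ℝ)))) =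
          Real.exp (-(j / ((2 * k + 1 : ℕ) : ℝ))) *
            Real.exp (-(j * (j - 1) / (2 * ((2 * k + 1 : ℕ) : ℝ)))) := by
        rw [← Real.exp_add]
        congr 1
        push_cast
        field_simp
        ring
      have h2 := mul_le_mul hfac h (by positivity) (by positivity)
      rw [hexp, Nat.cast_mul, Nat.cast_mul]
      linarith

open Finset in
lemma filter_balanced_mono_subset {v m : ℕ} {e : Finset (Fin v)} (he : e.Nonempty) :
    ({χ : Fin v → Bool | #{x | χ x = true} = m ∧ ∀ x ∈ e, ∀ y ∈ e, χ x = χ y} :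
        Finset (Fin v → Bool)) ⊆
      (eᶜ.powersetCard m).image (fun s x => decide (x ∈ s)) ∪
        (eᶜ.powersetCard (v - m)).image (fun s x => !decide (x ∈ s)) := by
  intro χ hχ
  obtain ⟨hm, hχ⟩ := (mem_filter_univ _).1 hχ
  obtain ⟨a, ha⟩ := he
  rw [mem_union, mem_image, mem_image]
  rcases hc : χ a with _ | _
  · refine Or.inl ⟨({x | χ x = true} : Finset (Fin v)), mem_powersetCard.2 ⟨fun x hx => ?_, hm⟩, ?_⟩
    · rw [mem_compl]
      intro hxe
      simp [hχ x hxe a ha, hc] at hx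
    · funext x
      simp
  · refine Or.inr ⟨({x | χ x = true} : Finset (Fin v))ᶜ,
      mem_powersetCard.2 ⟨fun x hx => ?_, ?_⟩, ?_⟩
    · rw [mem_compl]
      intro hxe
      simp [hχ x hxe a ha, hc] at hx
    · rw [card_compl, hm, Fintype.card_fin]
    · funext x
      simp

open Finset in
lemma card_filter_balanced_mono_le {v m : ℕ} {e : Finset (Fin v)} (he : e.Nonempty) :
    #{χ : Fin v → Bool | #{x | χ x = true} = m ∧ ∀ x ∈ e, ∀ y ∈ e, χ x = χ y} ≤
      (v - #e).choose m + (v - #e).choose (v - m) := by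
  refine (card_le_card (filter_balanced_mono_subset he)).trans <|
    (card_union_le _ _).trans (add_le_add ?_ ?_) <;>
  · refine card_image_le.trans_eq ?_
    rw [card_powersetCard, card_compl, Fintype.card_fin]

lemma choose_add_choose_le {v n : ℕ} (hn : 0 < n) (hnv : n ≤ v) :
    (((v - n).choose ((v + 1) / 2) + (v - n).choose (v - (v + 1) / 2) : ℕ) : ℝ) ≤
      ((2 : ℝ) ^ (n - 1))⁻¹ * Real.exp (-(n * (n - 1) / (2 * v))) *
        v.choose ((v + 1) / 2) := by
  have hm : (v + 1) / 2 ≤ v := by omega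
  have h1 := choose_sub_mul_descFactorial v n ((v + 1) / 2)
  have h2 := choose_sub_mul_descFactorial v n (v - (v + 1) / 2)
  rw [Nat.choose_symm hm, Nat.sub_sub_self hm] at h2
  have h3 : ((v - n).choose ((v + 1) / 2) + (v - n).choose (v - (v + 1) / 2)) *
      v.descFactorial n = v.choose ((v + 1) / 2) *
        (((v + 1) / 2).descFactorial n + (v - (v + 1) / 2).descFactorial n) := by
    rw [add_mul, h1, h2]
    ring
  have h4 := mul_le_mul_of_nonneg_left (two_pow_mul_descFactorial_add_le (hn.trans_le hnv) hn)
    (Nat.cast_nonneg (α := ℝ) (v.choose ((v + 1) / 2)))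
  have h5 : (0 : ℝ) < v.descFactorial n := by exact_mod_cast Nat.descFactorial_pos.2 hnv
  have h3' := congrArg (Nat.cast (R := ℝ)) h3
  rw [Nat.cast_mul, Nat.cast_mul] at h3'
  rw [mul_assoc, inv_mul_eq_div, le_div_iff₀ (by positivity)]
  refine le_of_mul_le_mul_right ?_ h5
  linear_combination h4 + (2 : ℝ) ^ (n - 1) * h3'

lemma div_eight_le {n v : ℕ} (hn : 2 ≤ n) (hv : 0 < v) {t : ℝ} (ht : 0 < t)
    (h : (v : ℝ) ≤ (n : ℝ) ^ 2 / t) : t / 8 ≤ n * (n - 1) / (2 * v) := by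
  have hv' : (0 : ℝ) < v := by exact_mod_cast hv
  have hn' : (2 : ℝ) ≤ n := by exact_mod_cast hn
  rw [le_div_iff₀ ht] at h
  rw [div_le_div_iff₀ (by norm_num) (by positivity)]
  nlinarith


open Classical

/-- The number of balanced two-colorings of `[v]` (those whose `true`/Red class has
exactly `⌈v/2⌉` vertices) leaving some hyperedge of an `n`-uniform hypergraph `E`
monochromatic is at most `2^(-(n-1)) * exp(-t/8) * |E| * C(v, ⌈v/2⌉)`. -/
theorem balanced_coloring_bad_count
    (n : ℕ) (hn : 2 ≤ n) (t : ℝ) (ht : 4 ≤ t)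
    (v : ℕ) (hv : (v : ℝ) ≤ (n : ℝ) ^ 2 / t)
    (E : Finset (Finset (Fin v)))
    (huniform : ∀ e ∈ E, e.card = n) :
    (((Finset.univ : Finset (Fin v → Bool)).filter
        (fun χ => (Finset.univ.filter fun x => χ x = true).card = (v + 1) / 2 ∧
          ∃ e ∈ E, ∀ x ∈ e, ∀ y ∈ e, χ x = χ y)).card : ℝ) ≤
      ((2 : ℝ) ^ (n - 1))⁻¹ * Real.exp (-(t / 8)) * E.card * (v.choose ((v + 1) / 2)) := by
  have hedge : ∀ e ∈ E, (((Finset.univ : Finset (Fin v → Bool)).filter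
      (fun χ => (Finset.univ.filter fun x => χ x = true).card = (v + 1) / 2 ∧
        ∀ x ∈ e, ∀ y ∈ e, χ x = χ y)).card : ℝ) ≤
      ((2 : ℝ) ^ (n - 1))⁻¹ * Real.exp (-(t / 8)) * v.choose ((v + 1) / 2) := by
    intro e he
    have hcard := huniform e he
    have hnv : n ≤ v := by simpa [hcard] using e.card_le_univ
    have hle := card_filter_balanced_mono_le (m := (v + 1) / 2)
      (Finset.card_pos.1 (by omega : 0 < e.card))
    rw [hcard] at hle
    calc _ ≤ (((v - n).choose ((v + 1) / 2) + (v - n).choose (v - (v + 1) / 2) : ℕ) : ℝ) := by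
          refine Nat.cast_le.2 (le_trans (le_of_eq ?_) hle)
          congr!
      _ ≤ _ := choose_add_choose_le (by omega) hnv
      _ ≤ _ := by
          gcongr _ * Real.exp (-?_) * _
          exact div_eight_le hn (by omega) (by linarith) hv
  have hunion : (Finset.univ : Finset (Fin v → Bool)).filter
      (fun χ => (Finset.univ.filter fun x => χ x = true).card = (v + 1) / 2 ∧
        ∃ e ∈ E, ∀ x ∈ e, ∀ y ∈ e, χ x = χ y) ⊆
      E.biUnion fun e => (Finset.univ : Finset (Fin v → Bool)).filter
        (fun χ => (Finset.univ.filter fun x => χ x = true).card = (v + 1) / 2 ∧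
          ∀ x ∈ e, ∀ y ∈ e, χ x = χ y) := by
    intro χ hχ
    obtain ⟨hm, e, he, hmono⟩ := (Finset.mem_filter_univ _).1 hχ
    exact Finset.mem_biUnion.2 ⟨e, he, (Finset.mem_filter_univ _).2 ⟨hm, hmono⟩⟩
  refine (Nat.cast_le.2 ((Finset.card_le_card hunion).trans Finset.card_biUnion_le)).trans ?_
  rw [Nat.cast_sum]
  refine (Finset.sum_le_card_nsmul E _ _ hedge).trans_eq ?_
  rw [nsmul_eq_mul]
  ring
end

section
/- For every integer n ≥ 100, every n-uniform hypergraph with at most n²/(8 ln(2n)) vertices and at most n²·2^n hyperedges is two-colorable. -/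
/-- Removing one more point from a set of `v - i` points at least roughly halves the number of
`k`-subsets when `k` is about half of `v`. -/
lemma two_mul_choose_sub_succ_le {v k i : ℕ} (hk : v ≤ 2 * k + 1) (hi : i < v) :
    2 * ((v - (i + 1)).choose k : ℝ) ≤
      ((v - i).choose k : ℝ) * Real.exp (-((i : ℝ) - 1) / v) := by
  obtain ⟨w, rfl⟩ : ∃ w, v = w + 1 + i := ⟨v - i - 1, by omega⟩
  rw [show w + 1 + i - (i + 1) = w by omega, show w + 1 + i - i = w + 1 by omega]
  rcases lt_or_ge w k with hwk | hwk
  · rw [Nat.choose_eq_zero_of_lt hwk]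
    simp only [Nat.cast_zero, mul_zero]
    positivity
  have hrec : (w.choose k : ℝ) * (w + 1) = ((w + 1).choose k : ℝ) * (w + 1 - k) := by
    have h := congrArg (Nat.cast (R := ℝ)) (Nat.choose_mul_succ_eq w k)
    rw [Nat.cast_mul, Nat.cast_mul, Nat.cast_sub (by omega)] at h
    exact_mod_cast h
  have hk' : (w : ℝ) + 1 + i ≤ 2 * k + 1 := by exact_mod_cast hk
  have hfrac : ((w : ℝ) + 1) * (((i : ℝ) - 1) / (w + 1 + i)) ≤ (i : ℝ) - 1 := by
    rcases Nat.eq_zero_or_pos i with rfl | hi'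
    · simp only [Nat.cast_zero, add_zero]
      field_simp
      rfl
    · have h1 : (1 : ℝ) ≤ i := by exact_mod_cast hi'
      rw [mul_div_assoc', div_le_iff₀ (by positivity)]
      nlinarith
  have hexp := Real.add_one_le_exp (-((i : ℝ) - 1) / (w + 1 + i))
  rw [neg_div] at hexp
  have hlin : 2 * ((w : ℝ) + 1 - k) ≤
      (w + 1) * Real.exp (-(((i : ℝ) - 1) / (w + 1 + i))) := by
    have := mul_le_mul_of_nonneg_left hexp (by positivity : (0 : ℝ) ≤ w + 1)
    linarith
  have hmul := mul_le_mul_of_nonneg_left hlin (Nat.cast_nonneg (α := ℝ) ((w + 1).choose k))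
  push_cast
  rw [neg_div]
  refine le_of_mul_le_mul_right ?_ (by positivity : (0 : ℝ) < w + 1)
  linarith

lemma two_pow_mul_choose_sub_le {v k : ℕ} (hk : v ≤ 2 * k + 1) {n : ℕ} (hn : n ≤ v) :
    2 ^ n * ((v - n).choose k : ℝ) ≤
      (v.choose k : ℝ) * Real.exp (-((n : ℝ) * (n - 3)) / (2 * v)) := by
  induction n with
  | zero => simp
  | succ i ih =>
    have hv : (0 : ℝ) < v := by exact_mod_cast (by omega : 0 < v)
    calc 2 ^ (i + 1) * ((v - (i + 1)).choose k : ℝ)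
        = 2 ^ i * (2 * ((v - (i + 1)).choose k : ℝ)) := by ring
      _ ≤ 2 ^ i * (((v - i).choose k : ℝ) * Real.exp (-((i : ℝ) - 1) / v)) := by
          exact mul_le_mul_of_nonneg_left (two_mul_choose_sub_succ_le hk hn) (by positivity)
      _ = (2 ^ i * ((v - i).choose k : ℝ)) * Real.exp (-((i : ℝ) - 1) / v) := by ring
      _ ≤ ((v.choose k : ℝ) * Real.exp (-((i : ℝ) * (i - 3)) / (2 * v))) *
            Real.exp (-((i : ℝ) - 1) / v) := by
          exact mul_le_mul_of_nonneg_right (ih (by omega)) (Real.exp_nonneg _)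
      _ = _ := by
          rw [mul_assoc, ← Real.exp_add]
          congr 2
          push_cast
          field_simp
          ring

/-- A union bound over the colorings with exactly `m` vertices in the first color class. -/
lemma exists_two_coloring_of_card_mul_lt {V : Type*} [Fintype V] [DecidableEq V]
    {E : Finset (Finset V)} {n m : ℕ} (huniform : ∀ e ∈ E, e.card = n)
    (hlt : E.card * ((Fintype.card V - n).choose m +
      (Fintype.card V - n).choose (Fintype.card V - m)) < (Fintype.card V).choose m) :
    ∃ χ : V → Bool, ∀ e ∈ E, ∃ x ∈ e, ∃ y ∈ e, χ x ≠ χ y := by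
  let bad : Finset V → Finset (Finset V) := fun e =>
    eᶜ.powersetCard m ∪ (eᶜ.powersetCard (Fintype.card V - m)).image compl
  have hbad : ∀ e ∈ E, (bad e).card ≤ (Fintype.card V - n).choose m +
      (Fintype.card V - n).choose (Fintype.card V - m) := by
    intro e he
    refine (Finset.card_union_le _ _).trans (add_le_add ?_ (Finset.card_image_le.trans ?_)) <;>
    rw [Finset.card_powersetCard, Finset.card_compl, huniform e he]
  obtain ⟨S, hS, hS'⟩ : ∃ S ∈ Finset.univ.powersetCard m, S ∉ E.biUnion bad := by
    refine Finset.exists_mem_notMem_of_card_lt_card ?_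
    rw [Finset.card_powersetCard, Finset.card_univ]
    exact (Finset.card_biUnion_le_card_mul _ _ _ hbad).trans_lt hlt
  have hcard : S.card = m := (Finset.mem_powersetCard.1 hS).2
  refine ⟨fun x => decide (x ∈ S), fun e he => ?_⟩
  have hSe : S ∉ bad e := fun h => hS' (Finset.mem_biUnion.2 ⟨e, he, h⟩)
  simp only [bad, Finset.mem_union, Finset.mem_powersetCard, Finset.mem_image, not_or] at hSe
  obtain ⟨hdisj, hsub⟩ := hSe
  obtain ⟨x, hxe, hxS⟩ : ∃ x ∈ e, x ∈ S := by
    by_contra! h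
    exact hdisj ⟨fun x hx => Finset.mem_compl.2 fun hxe => h x hxe hx, hcard⟩
  obtain ⟨y, hye, hyS⟩ : ∃ y ∈ e, y ∉ S := by
    by_contra! h
    refine hsub ⟨Sᶜ, ⟨Finset.compl_subset_compl.2 h, ?_⟩, compl_compl S⟩
    rw [Finset.card_compl, hcard]
  exact ⟨x, hxe, y, hye, by simp [hxS, hyS]⟩

/-- For `n ≥ 100`, every `n`-uniform hypergraph with at most `n²/(8 ln(2n))` vertices
and at most `n² · 2^n` hyperedges is two-colorable. -/
theorem two_colorable_of_very_few_vertices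
    (n : ℕ) (hn : 100 ≤ n)
    (v : ℕ) (hv : (v : ℝ) ≤ (n : ℝ) ^ 2 / (8 * Real.log (2 * (n : ℝ))))
    (E : Finset (Finset (Fin v)))
    (huniform : ∀ e ∈ E, e.card = n)
    (hE : E.card ≤ n ^ 2 * 2 ^ n) :
    ∃ χ : Fin v → Bool, ∀ e ∈ E, ∃ x ∈ e, ∃ y ∈ e, χ x ≠ χ y := by
  rcases E.eq_empty_or_nonempty with rfl | ⟨e₀, he₀⟩
  · exact ⟨fun _ => true, by simp⟩
  have hnv : n ≤ v := by
    have h := e₀.card_le_univ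
    rwa [huniform e₀ he₀, Fintype.card_fin] at h
  have hn' : (100 : ℝ) ≤ n := by exact_mod_cast hn
  have hv0 : (0 : ℝ) < v := by exact_mod_cast (by omega : 0 < v)
  have hlog : 0 < Real.log (2 * (n : ℝ)) := Real.log_pos (by linarith)
  have hexp : Real.exp (-((n : ℝ) * (n - 3)) / (2 * v)) ≤ ((2 * (n : ℝ)) ^ 3)⁻¹ := by
    rw [← Real.exp_log (by positivity : (0 : ℝ) < 2 * n), ← Real.exp_nat_mul, ← Real.exp_neg,
      Real.exp_le_exp, neg_div, neg_le_neg_iff,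
      le_div_iff₀ (by positivity)]
    rw [le_div_iff₀ (by positivity)] at hv
    push_cast
    nlinarith
  refine exists_two_coloring_of_card_mul_lt (m := v / 2) huniform ?_
  rw [Fintype.card_fin]
  have hbound₁ := two_pow_mul_choose_sub_le (k := v / 2) (by omega) hnv
  have hbound₂ := two_pow_mul_choose_sub_le (k := v - v / 2) (by omega) hnv
  rw [Nat.choose_symm (Nat.div_le_self v 2)] at hbound₂
  have hC : (0 : ℝ) < v.choose (v / 2) := by
    exact_mod_cast Nat.choose_pos (Nat.div_le_self v 2)
  have hE' : (E.card : ℝ) ≤ (n : ℝ) ^ 2 * 2 ^ n := by exact_mod_cast hE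
  have hsmall : (n : ℝ) ^ 2 * (2 * ((2 * (n : ℝ)) ^ 3)⁻¹) < 1 := by
    rw [← div_eq_mul_inv, mul_div_assoc', div_lt_one (by positivity)]
    nlinarith [pow_pos (by linarith : (0 : ℝ) < n) 2]
  have hreal : (E.card : ℝ) * (((v - n).choose (v / 2) : ℝ) +
      ((v - n).choose (v - v / 2) : ℝ)) < (v.choose (v / 2) : ℝ) := by
    calc _ ≤ (n : ℝ) ^ 2 * 2 ^ n * (((v - n).choose (v / 2) : ℝ) +
              ((v - n).choose (v - v / 2) : ℝ)) := by gcongr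
      _ = (n : ℝ) ^ 2 * (2 ^ n * ((v - n).choose (v / 2) : ℝ) +
              2 ^ n * ((v - n).choose (v - v / 2) : ℝ)) := by ring
      _ ≤ (n : ℝ) ^ 2 * ((v.choose (v / 2) : ℝ) * ((2 * (n : ℝ)) ^ 3)⁻¹ +
              (v.choose (v / 2) : ℝ) * ((2 * (n : ℝ)) ^ 3)⁻¹) := by
          refine mul_le_mul_of_nonneg_left (add_le_add ?_ ?_) (by positivity)
          · exact hbound₁.trans (by gcongr)
          · exact hbound₂.trans (by gcongr)
      _ = (v.choose (v / 2) : ℝ) * ((n : ℝ) ^ 2 * (2 * ((2 * (n : ℝ)) ^ 3)⁻¹)) := by ring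
      _ < _ := mul_lt_of_lt_one_right hC hsmall
  exact_mod_cast hreal
end

section
/- Let n ≥ 2 and N be integers with N ≥ 2n+1, and set t = n²/N (so that 0 < t < n/2). Then there exists an n-uniform hypergraph on the vertex set [N] with at most ⌈N · 2^n · exp(tn/(n−2t))⌉ hyperedges that is not two-colorable. -/
/-- One step of the greedy cover: if every element of `U` is hit by at least a `p`-fraction of `S`,
then some element of `S` misses at most an `exp (-p)`-fraction of `U`. -/
theorem exists_card_filter_not_le_exp_neg_mul {α β : Type*} {S : Finset α} (hS : S.Nonempty)
    (U : Finset β) (r : α → β → Prop) [∀ a b, Decidable (r a b)] {p : ℝ}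
    (h : ∀ b ∈ U, p * S.card ≤ (S.filter (r · b)).card) :
    ∃ a ∈ S, ((U.filter fun b => ¬ r a b).card : ℝ) ≤ Real.exp (-p) * U.card := by
  have hcount : ∑ a ∈ S, p * (U.card : ℝ) ≤ ∑ a ∈ S, ((U.filter (r a)).card : ℝ) := by
    have hdouble : ∑ a ∈ S, ((U.filter (r a)).card : ℝ)
        = ∑ b ∈ U, ((S.filter (r · b)).card : ℝ) := by
      exact_mod_cast Finset.sum_card_bipartiteAbove_eq_sum_card_bipartiteBelow (s := S) (t := U) r
    rw [hdouble]
    calc ∑ a ∈ S, p * (U.card : ℝ) = ∑ b ∈ U, p * (S.card : ℝ) := by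
          simp only [Finset.sum_const, nsmul_eq_mul]; ring
      _ ≤ _ := Finset.sum_le_sum h
  obtain ⟨a, ha, hle⟩ := Finset.exists_le_of_sum_le hS hcount
  refine ⟨a, ha, ?_⟩
  have hsplit : ((U.filter (r a)).card : ℝ) + (U.filter fun b => ¬ r a b).card = U.card := by
    exact_mod_cast Finset.card_filter_add_card_filter_not (s := U) (r a)
  have hexp := Real.add_one_le_exp (-p)
  have := mul_le_mul_of_nonneg_right hexp (Nat.cast_nonneg (α := ℝ) U.card)
  linarith

/-- Greedy cover: if every element of `U` is hit by at least a `p`-fraction of `S`, then some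
`m` elements of `S` together miss at most an `exp (-p * m)`-fraction of `U`. -/
theorem exists_subset_card_le_card_uncovered_le {α β : Type*} [DecidableEq α] {S : Finset α}
    (hS : S.Nonempty) (U : Finset β) (r : α → β → Prop) [∀ a b, Decidable (r a b)] {p : ℝ}
    (h : ∀ b ∈ U, p * S.card ≤ (S.filter (r · b)).card) (m : ℕ) :
    ∃ E ⊆ S, E.card ≤ m ∧
      ((U.filter fun b => ∀ a ∈ E, ¬ r a b).card : ℝ) ≤ Real.exp (-p * m) * U.card := by
  induction m with
  | zero => exact ⟨∅, by simp⟩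
  | succ m ih =>
    obtain ⟨E, hES, hEm, hE⟩ := ih
    obtain ⟨a, ha, hle⟩ := exists_card_filter_not_le_exp_neg_mul hS
      (U.filter fun b => ∀ a ∈ E, ¬ r a b) r fun b hb => h b (Finset.mem_filter.1 hb).1
    refine ⟨insert a E, Finset.insert_subset ha hES, (Finset.card_insert_le a E).trans (by omega),
      ?_⟩
    have heq : (U.filter fun b => ∀ x ∈ insert a E, ¬ r x b)
        = (U.filter fun b => ∀ x ∈ E, ¬ r x b).filter fun b => ¬ r a b := by
      ext b
      simp only [Finset.mem_filter, Finset.forall_mem_insert]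
      tauto
    rw [heq]
    calc _ ≤ Real.exp (-p) * (Real.exp (-p * m) * U.card) :=
          hle.trans (mul_le_mul_of_nonneg_left hE (Real.exp_pos _).le)
      _ = Real.exp (-p * (m + 1 : ℕ)) * U.card := by
          rw [← mul_assoc, ← Real.exp_add]; push_cast; ring_nf

theorem exists_subset_card_le_forall_exists {α β : Type*} [DecidableEq α] {S : Finset α}
    (hS : S.Nonempty) (U : Finset β) (r : α → β → Prop) [∀ a b, Decidable (r a b)] {p : ℝ}
    (h : ∀ b ∈ U, p * S.card ≤ (S.filter (r · b)).card) {m : ℕ}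
    (hm : Real.exp (-p * m) * U.card < 1) :
    ∃ E ⊆ S, E.card ≤ m ∧ ∀ b ∈ U, ∃ a ∈ E, r a b := by
  obtain ⟨E, hES, hEm, hE⟩ := exists_subset_card_le_card_uncovered_le hS U r h m
  refine ⟨E, hES, hEm, fun b hb => ?_⟩
  have hempty := Finset.card_eq_zero.1 (Nat.lt_one_iff.1 (by exact_mod_cast hE.trans_lt hm))
  have hb' := Finset.filter_eq_empty_iff.1 hempty hb
  push Not at hb'
  exact hb'

theorem Nat.cast_choose_le_choose_mul_pow {n N h : ℕ} {c : ℝ} (hn : n ≤ h)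
    (hN : n ≤ N) (hstep : ∀ k < n, (N : ℝ) - k ≤ ((h : ℝ) - k) * c) :
    (N.choose n : ℝ) ≤ h.choose n * c ^ n := by
  have hdesc : ∀ k ≤ n, (N.descFactorial k : ℝ) ≤ h.descFactorial k * c ^ k := by
    intro k hk
    induction k with
    | zero => simp
    | succ k ih =>
      rw [Nat.descFactorial_succ, Nat.descFactorial_succ, Nat.cast_mul, Nat.cast_mul,
        Nat.cast_sub (by omega), Nat.cast_sub (by omega)]
      have hk0 : (0 : ℝ) ≤ (N : ℝ) - k := sub_nonneg.2 (by exact_mod_cast (by omega : k ≤ N))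
      calc ((N : ℝ) - k) * N.descFactorial k
          ≤ (((h : ℝ) - k) * c) * (h.descFactorial k * c ^ k) :=
            mul_le_mul (hstep k (by omega)) (ih (by omega)) (Nat.cast_nonneg _)
              (hk0.trans (hstep k (by omega)))
        _ = _ := by ring
  have h1 := hdesc n le_rfl
  rw [Nat.descFactorial_eq_factorial_mul_choose, Nat.descFactorial_eq_factorial_mul_choose] at h1
  push_cast at h1
  rw [mul_assoc] at h1
  exact le_of_mul_le_mul_left h1 (by exact_mod_cast n.factorial_pos)

/-- A set containing at least half of `N` points contains at least a
`2⁻ⁿ exp (-n² / (N - 2n))`-fraction of the `n`-subsets. -/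
theorem Nat.cast_choose_le_choose_mul_two_pow_mul_exp {n N h : ℕ} (hN : 2 * n + 1 ≤ N)
    (hh : N ≤ 2 * h) :
    (N.choose n : ℝ) ≤ h.choose n * (2 ^ n * Real.exp ((n : ℝ) ^ 2 / (N - 2 * n))) := by
  have hpos : (0 : ℝ) < N - 2 * n := by
    have : (2 * n + 1 : ℝ) ≤ N := by exact_mod_cast hN
    linarith
  have key := Nat.cast_choose_le_choose_mul_pow (n := n) (N := N) (h := h)
    (c := 2 * Real.exp (n / (N - 2 * n))) (by omega) (by omega) ?_
  · rwa [mul_pow, ← Real.exp_nat_mul,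
      show (n : ℝ) * (n / (N - 2 * n)) = (n : ℝ) ^ 2 / (N - 2 * n) by ring] at key
  · intro k hk
    have hkn : (k : ℝ) ≤ n := by exact_mod_cast hk.le
    have hh' : (N : ℝ) ≤ 2 * h := by exact_mod_cast hh
    have hexp := Real.add_one_le_exp ((n : ℝ) / (N - 2 * n))
    have hn : (n : ℝ) = n / (N - 2 * n) * (N - 2 * n) := (div_mul_cancel₀ _ hpos.ne').symm
    have hx : (0 : ℝ) ≤ n / (N - 2 * n) := by positivity
    calc (N : ℝ) - k ≤ (N - 2 * k) * (n / (N - 2 * n) + 1) := by nlinarith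
      _ ≤ (2 * (h - k)) * Real.exp (n / (N - 2 * n)) :=
          mul_le_mul (by linarith) hexp (by linarith) (by linarith)
      _ = _ := by ring

theorem choose_le_card_monochromatic {n N : ℕ} (hN : 2 * n + 1 ≤ N) (χ : Fin N → Bool) :
    (N.choose n : ℝ) ≤ (((Finset.univ : Finset (Fin N)).powersetCard n).filter
      fun e => ∀ x ∈ e, ∀ y ∈ e, χ x = χ y).card *
        (2 ^ n * Real.exp ((n : ℝ) ^ 2 / (N - 2 * n))) := by
  obtain ⟨b, hb⟩ : ∃ b, N ≤ 2 * (Finset.univ.filter fun x => χ x = b).card := by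
    by_contra! hcon
    have h := Finset.card_filter_add_card_filter_not (s := (Finset.univ : Finset (Fin N)))
      fun x => χ x = true
    simp only [Bool.not_eq_true, Finset.card_univ, Fintype.card_fin] at h
    have h1 := hcon true
    have h2 := hcon false
    omega
  refine (Nat.cast_choose_le_choose_mul_two_pow_mul_exp hN hb).trans ?_
  gcongr
  rw [← Finset.card_powersetCard]
  refine Finset.card_le_card fun e he => ?_
  rw [Finset.mem_powersetCard] at he
  refine Finset.mem_filter.2 ⟨Finset.mem_powersetCard.2 ⟨Finset.subset_univ e, he.2⟩, ?_⟩
  intro x hx y hy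
  rw [(Finset.mem_filter.1 (he.1 hx)).2, (Finset.mem_filter.1 (he.1 hy)).2]


/-- **Theorem 1(b)-style construction**: for `n ≥ 2` and `N ≥ 2n+1`, with `t = n²/N`,
there is an `n`-uniform hypergraph on `[N]` with at most
`⌈N · 2^n · exp(tn/(n-2t))⌉` hyperedges that is not two-colorable. -/
theorem exists_non_two_colorable
    (n N : ℕ) (hn : 2 ≤ n) (hN : 2 * n + 1 ≤ N)
    (t : ℝ) (ht : t = (n : ℝ) ^ 2 / N) :
    ∃ E : Finset (Finset (Fin N)),
      (∀ e ∈ E, e.card = n) ∧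
      (E.card : ℤ) ≤ ⌈(N : ℝ) * 2 ^ n * Real.exp (t * n / ((n : ℝ) - 2 * t))⌉ ∧
      ∀ χ : Fin N → Bool, ∃ e ∈ E, ∀ x ∈ e, ∀ y ∈ e, χ x = χ y := by
  have hNn : (2 * n + 1 : ℝ) ≤ N := by exact_mod_cast hN
  have hn0 : (0 : ℝ) < n := by exact_mod_cast (by omega : 0 < n)
  have hN0 : (0 : ℝ) < N := by linarith
  have hpos : (0 : ℝ) < N - 2 * n := by linarith
  have hexponent : t * n / ((n : ℝ) - 2 * t) = (n : ℝ) ^ 2 / (N - 2 * n) := by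
    have hden : (n : ℝ) - 2 * t = n * (N - 2 * n) / N := by
      rw [ht]; field_simp
    rw [hden, ht]
    field_simp
  rw [hexponent, mul_assoc]
  set D : ℝ := 2 ^ n * Real.exp ((n : ℝ) ^ 2 / (N - 2 * n))
  have hD0 : 0 < D := by positivity
  have hS : ((Finset.univ : Finset (Fin N)).powersetCard n).Nonempty :=
    Finset.powersetCard_nonempty.2 (by simp; omega)
  have hm : Real.exp (-D⁻¹ * ⌈(N : ℝ) * D⌉₊) * (Finset.univ : Finset (Fin N → Bool)).card
      < 1 := by
    have hle : (N : ℝ) ≤ D⁻¹ * ⌈(N : ℝ) * D⌉₊ := by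
      rw [le_inv_mul_iff₀ hD0, mul_comm]
      exact Nat.le_ceil _
    have htwo : (2 : ℝ) ^ N < Real.exp N := by
      rw [← mul_one (N : ℝ), Real.exp_nat_mul]
      exact pow_lt_pow_left₀ (by linarith [Real.exp_one_gt_d9]) (by norm_num) (by omega)
    rw [neg_mul, Real.exp_neg, inv_mul_lt_iff₀ (Real.exp_pos _), mul_one]
    simpa using htwo.trans_le (Real.exp_le_exp.2 hle)
  obtain ⟨E, hES, hEm, hE⟩ := exists_subset_card_le_forall_exists hS
    (Finset.univ : Finset (Fin N → Bool)) (fun e χ => ∀ x ∈ e, ∀ y ∈ e, χ x = χ y) (p := D⁻¹)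
    (fun χ _ => by
      rw [Finset.card_powersetCard, Finset.card_univ, Fintype.card_fin, inv_mul_le_iff₀ hD0,
        mul_comm D]
      exact choose_le_card_monochromatic hN χ) hm
  refine ⟨E, fun e he => (Finset.mem_powersetCard.1 (hES he)).2, ?_,
    fun χ => hE χ (Finset.mem_univ χ)⟩
  rw [← Int.natCast_ceil_eq_ceil (by positivity)]
  exact_mod_cast hEm
end

section
/- Let n ≥ 100 and k ≥ 2 be integers and let t be a real number with 4 ≤ t and kt < n, and suppose ⌊n²/t⌋ ≥ kn. Then there exists an n-uniform hypergraph on ⌊n²/t⌋ vertices with at most (n²/t)·k^n·exp((k−1)tn/(n−kt)) hyperedges that is not k-colorable. -/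
open Finset in
/-- Greedy covering: if every `c` is related to at least a `p`-fraction of `S`, then some `m`
elements of `S` leave at most a `(1 - p) ^ m`-fraction of the `c`'s uncovered. -/
theorem exists_greedy_cover {α β : Type*} [Fintype α] [DecidableEq β]
    (S : Finset β) (hS : S.Nonempty) (R : α → β → Prop) [∀ a b, Decidable (R a b)]
    (p : ℝ) (hp1 : p ≤ 1) (h : ∀ a, p * #S ≤ #{b ∈ S | R a b}) (m : ℕ) :
    ∃ E ⊆ S, #E ≤ m ∧ (#{a : α | ∀ b ∈ E, ¬ R a b} : ℝ) ≤ (1 - p) ^ m * Fintype.card α := by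
  induction m with
  | zero => exact ⟨∅, by simp, by simp, by simp⟩
  | succ m ih =>
    obtain ⟨E, hES, hEm, hE⟩ := ih
    set U : Finset α := {a : α | ∀ b ∈ E, ¬ R a b} with hU
    have hdouble : ∑ b ∈ S, (#{a ∈ U | R a b} : ℝ) = ∑ a ∈ U, (#{b ∈ S | R a b} : ℝ) := by
      exact_mod_cast (sum_card_bipartiteAbove_eq_sum_card_bipartiteBelow R (s := U) (t := S)).symm
    have hsum : ∑ b ∈ S, p * (#U : ℝ) ≤ ∑ b ∈ S, (#{a ∈ U | R a b} : ℝ) := by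
      rw [hdouble]
      calc ∑ b ∈ S, p * (#U : ℝ) = ∑ a ∈ U, p * (#S : ℝ) := by simp; ring
        _ ≤ _ := sum_le_sum fun a _ => h a
    obtain ⟨b, hbS, hb⟩ := exists_le_of_sum_le hS hsum
    refine ⟨insert b E, insert_subset hbS hES, (card_insert_le _ _).trans (by omega), ?_⟩
    have hnew : ({a : α | ∀ b' ∈ insert b E, ¬ R a b'} : Finset α) = {a ∈ U | ¬ R a b} := by
      ext a; simp [hU, and_comm]
    have hsplit : (#{a ∈ U | R a b} : ℝ) + #{a ∈ U | ¬ R a b} = #U := by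
      exact_mod_cast card_filter_add_card_filter_not (s := U) (fun a => R a b)
    rw [hnew, pow_succ]
    have := mul_le_mul_of_nonneg_left hE (sub_nonneg.2 hp1)
    linarith

/-- A comparison of binomial coefficients: if `v ≤ k * s`, then `v.choose n` exceeds
`k ^ n * s.choose n` by a factor at most `exp ((k - 1) * n ^ 2 / (2 * D))`, for any positive
`D ≤ v - k * (n - 1)`. -/
theorem choose_le_pow_mul_exp_mul_choose {n k s v : ℕ} (hk : 1 ≤ k) (hsv : v ≤ k * s)
    (hns : n ≤ s) (hnv : n ≤ v) {D : ℝ} (hD : 0 < D) (hDv : D ≤ v - k * ((n : ℝ) - 1)) :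
    (v.choose n : ℝ) ≤
      (k : ℝ) ^ n * Real.exp (((k : ℝ) - 1) * n ^ 2 / (2 * D)) * s.choose n := by
  have hk' : (1 : ℝ) ≤ k := by exact_mod_cast hk
  have hsv' : (v : ℝ) ≤ k * s := by exact_mod_cast hsv
  have hprod : (v.descFactorial n : ℝ) ≤
      ∏ i ∈ Finset.range n, ((k : ℝ) * Real.exp (((k : ℝ) - 1) / D * i) * ((s - i : ℕ) : ℝ)) := by
    rw [Nat.descFactorial_eq_prod_range, Nat.cast_prod]
    refine Finset.prod_le_prod (fun _ _ => by positivity) fun i hi => ?_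
    have hi : i < n := Finset.mem_range.1 hi
    have hi' : (i : ℝ) ≤ n - 1 := by
      have : (i : ℝ) + 1 ≤ n := by exact_mod_cast hi
      linarith
    rw [Nat.cast_sub (by omega), Nat.cast_sub (by omega)]
    have hDi : D ≤ v - k * i := hDv.trans (by gcongr)
    have hexp := Real.add_one_le_exp (((k : ℝ) - 1) / D * i)
    have hx : ((k : ℝ) - 1) * i ≤ (v - k * i) * (((k : ℝ) - 1) / D * i) := by
      have h0 : 0 ≤ ((k : ℝ) - 1) / D * i := by
        have : 0 ≤ (k : ℝ) - 1 := by linarith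
        positivity
      calc ((k : ℝ) - 1) * i = D * (((k : ℝ) - 1) / D * i) := by field_simp
        _ ≤ _ := by gcongr
    calc (v : ℝ) - i ≤ (v - k * i) * (((k : ℝ) - 1) / D * i + 1) := by linarith
      _ ≤ (v - k * i) * Real.exp (((k : ℝ) - 1) / D * i) := by
        gcongr; linarith
      _ ≤ (k * s - k * i) * Real.exp (((k : ℝ) - 1) / D * i) := by gcongr
      _ = _ := by ring
  have hsum : ∑ i ∈ Finset.range n, ((k : ℝ) - 1) / D * i ≤ ((k : ℝ) - 1) * n ^ 2 / (2 * D) := by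
    have hG : (∑ i ∈ Finset.range n, (i : ℝ)) * 2 = n * (n - 1) := by
      rcases Nat.eq_zero_or_pos n with rfl | hn
      · simp
      · have := congrArg (Nat.cast (R := ℝ)) (Finset.sum_range_id_mul_two n)
        rw [Nat.cast_mul, Nat.cast_mul, Nat.cast_sub hn] at this
        push_cast at this
        exact this
    have h0 : 0 ≤ ((k : ℝ) - 1) / (2 * D) := div_nonneg (by linarith) (by linarith)
    calc ∑ i ∈ Finset.range n, ((k : ℝ) - 1) / D * i
        = ((k : ℝ) - 1) / (2 * D) * ((∑ i ∈ Finset.range n, (i : ℝ)) * 2) := by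
          rw [← Finset.mul_sum]; field_simp
      _ ≤ ((k : ℝ) - 1) / (2 * D) * n ^ 2 := by
          rw [hG]; gcongr; nlinarith [(Nat.cast_nonneg n : (0 : ℝ) ≤ n)]
      _ = _ := by ring
  have hdesc : (v.descFactorial n : ℝ) ≤
      (k : ℝ) ^ n * Real.exp (((k : ℝ) - 1) * n ^ 2 / (2 * D)) * s.descFactorial n := by
    refine hprod.trans ?_
    rw [Finset.prod_mul_distrib, Finset.prod_mul_distrib, ← Real.exp_sum, Finset.prod_const,
      Finset.card_range, Nat.descFactorial_eq_prod_range s, Nat.cast_prod]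
    gcongr
  rw [Nat.descFactorial_eq_factorial_mul_choose, Nat.descFactorial_eq_factorial_mul_choose,
    Nat.cast_mul, Nat.cast_mul] at hdesc
  have hf : (0 : ℝ) < n.factorial := by exact_mod_cast n.factorial_pos
  refine le_of_mul_le_mul_left ?_ hf
  linarith

open Finset in
/-- A `k`-coloring of `v` points has at least `s.choose n` monochromatic `n`-sets for some
`s ≥ v / k`. -/
theorem exists_choose_le_card_monochromatic {v k : ℕ} (hk : 0 < k) (n : ℕ) (χ : Fin v → Fin k) :
    ∃ s : ℕ, v ≤ k * s ∧
      s.choose n ≤ #{e ∈ powersetCard n (univ : Finset (Fin v)) | ∀ x ∈ e, ∀ y ∈ e, χ x = χ y} := by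
  have : Nonempty (Fin k) := ⟨⟨0, hk⟩⟩
  obtain ⟨j, -, hj⟩ := exists_le_of_sum_le (s := (univ : Finset (Fin k))) univ_nonempty
    (f := fun _ => (v : ℝ) / k) (g := fun j => (#{x | χ x = j} : ℝ)) (by
      have h := card_eq_sum_card_fiberwise (f := χ) (s := univ) (t := univ) (by simp)
      rw [sum_const, card_univ, Fintype.card_fin, nsmul_eq_mul,
        mul_div_cancel₀ _ (by positivity : (k : ℝ) ≠ 0)]
      rw [card_univ, Fintype.card_fin] at h
      exact_mod_cast h.le)
  refine ⟨#{x | χ x = j}, ?_, ?_⟩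
  · rw [div_le_iff₀' (by positivity)] at hj
    exact_mod_cast hj
  · rw [← card_powersetCard]
    refine card_le_card fun e he => ?_
    rw [mem_powersetCard] at he
    have hmem : ∀ x ∈ e, χ x = j := fun x hx => by simpa using he.1 hx
    simp only [mem_filter, mem_powersetCard, subset_univ, true_and]
    exact ⟨he.2, fun x hx y hy => (hmem x hx).trans (hmem y hy).symm⟩


/-- For `n ≥ 100`, `k ≥ 2`, `4 ≤ t` with `kt < n` and `⌊n²/t⌋ ≥ kn`, there exists an
`n`-uniform hypergraph on `⌊n²/t⌋` vertices with at most
`(n²/t) · k^n · exp((k-1)tn/(n-kt))` hyperedges that is not `k`-colorable. -/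
theorem exists_non_k_colorable
    (n k : ℕ) (hn : 100 ≤ n) (hk : 2 ≤ k)
    (t : ℝ) (ht4 : 4 ≤ t) (hkt : (k : ℝ) * t < n)
    (v : ℕ) (hv : v = ⌊(n : ℝ) ^ 2 / t⌋₊) (hvk : k * n ≤ v) :
    ∃ E : Finset (Finset (Fin v)),
      (∀ e ∈ E, e.card = n) ∧
      (E.card : ℝ) ≤ (n : ℝ) ^ 2 / t * (k : ℝ) ^ n *
        Real.exp (((k : ℝ) - 1) * t * n / ((n : ℝ) - k * t)) ∧
      ∀ χ : Fin v → Fin k, ∃ e ∈ E, ∀ x ∈ e, ∀ y ∈ e, χ x = χ y := by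
  classical
  have hk' : (2 : ℝ) ≤ k := by exact_mod_cast hk
  have hn' : (100 : ℝ) ≤ n := by exact_mod_cast hn
  have ht : 0 < t := by linarith
  have hnkt : 0 < (n : ℝ) - k * t := by linarith
  have hnv : n ≤ v := le_trans (Nat.le_mul_of_pos_left n (by omega)) hvk
  have hv1 : (1 : ℝ) ≤ v := by exact_mod_cast (by omega : 1 ≤ v)
  have hvle : (v : ℝ) ≤ (n : ℝ) ^ 2 / t := by
    rw [hv]; exact Nat.floor_le (by positivity)
  have hvlt : (n : ℝ) ^ 2 / t < v + 1 := by
    rw [hv]; exact Nat.lt_floor_add_one _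
  set x : ℝ := ((k : ℝ) - 1) * t * n / ((n : ℝ) - k * t) with hx
  set D : ℝ := n * ((n : ℝ) - k * t) / t with hD
  have hD0 : 0 < D := by positivity
  have hDv : D ≤ v - k * ((n : ℝ) - 1) := by
    have : D = (n : ℝ) ^ 2 / t - k * n := by rw [hD]; field_simp
    linarith
  have hxD : ((k : ℝ) - 1) * n ^ 2 / (2 * D) = x / 2 := by
    rw [hx, hD]; field_simp
  have hxk : 2 * ((k : ℝ) - 1) ≤ x / 2 := by
    rw [hx, le_div_iff₀ (by norm_num), le_div_iff₀ hnkt]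
    have h1 : (n : ℝ) - k * t ≤ n := by
      have : 0 ≤ (k : ℝ) * t := by positivity
      linarith
    have h2 : 4 * ((n : ℝ) - k * t) ≤ t * n := by nlinarith
    nlinarith
  set Q : ℝ := (k : ℝ) ^ n * Real.exp (x / 2) with hQ
  have hQ1 : 1 ≤ Q := one_le_mul_of_one_le_of_one_le (one_le_pow₀ (by linarith))
    (Real.one_le_exp (by linarith))
  have hQ0 : 0 < Q := by linarith
  have hp1 : Q⁻¹ ≤ 1 := inv_le_one_of_one_le₀ hQ1
  set B : ℝ := (n : ℝ) ^ 2 / t * (k : ℝ) ^ n * Real.exp x with hB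
  have hBQ : B = Q * ((n : ℝ) ^ 2 / t * Real.exp (x / 2)) := by
    have : Real.exp x = Real.exp (x / 2) * Real.exp (x / 2) := by
      rw [← Real.exp_add]; ring_nf
    rw [hB, this, hQ]; ring
  have hS : (Finset.powersetCard n (Finset.univ : Finset (Fin v))).Nonempty := by
    rw [Finset.powersetCard_nonempty]; simpa using hnv
  obtain ⟨E, hES, hEm, hE⟩ := exists_greedy_cover
    (Finset.powersetCard n (Finset.univ : Finset (Fin v))) hS
    (fun (χ : Fin v → Fin k) e => ∀ x ∈ e, ∀ y ∈ e, χ x = χ y) Q⁻¹ hp1 (by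
      intro χ
      obtain ⟨s, hsv, hs⟩ := exists_choose_le_card_monochromatic (by omega) n χ
      have hns : n ≤ s := Nat.le_of_mul_le_mul_left (hvk.trans hsv) (by omega)
      have hc := choose_le_pow_mul_exp_mul_choose (by omega) hsv hns hnv hD0 hDv
      rw [hxD] at hc
      rw [Finset.card_powersetCard, Finset.card_univ, Fintype.card_fin, inv_mul_le_iff₀ hQ0]
      refine hc.trans (mul_le_mul_of_nonneg_left ?_ hQ0.le)
      exact_mod_cast hs) ⌊B⌋₊
  refine ⟨E, fun e he => (Finset.mem_powersetCard.1 (hES he)).2,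
    (Nat.cast_le.2 hEm).trans (Nat.floor_le (by positivity)), ?_⟩
  have hsmall : (1 - Q⁻¹) ^ ⌊B⌋₊ * (Fintype.card (Fin v → Fin k) : ℝ) < 1 := by
    have hpm : (v : ℝ) * k ≤ Q⁻¹ * ⌊B⌋₊ := by
      have hfl : B - 1 ≤ ⌊B⌋₊ := (Nat.sub_one_lt_floor B).le
      have hexp : (k : ℝ) + 1 ≤ Real.exp (x / 2) := by
        have := Real.add_one_le_exp (x / 2)
        linarith
      calc (v : ℝ) * k ≤ v * (k + 1) - 1 := by linarith
        _ ≤ (n : ℝ) ^ 2 / t * Real.exp (x / 2) - Q⁻¹ := by gcongr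
        _ = Q⁻¹ * (B - 1) := by rw [hBQ]; field_simp
        _ ≤ _ := by gcongr
    have hlog : Real.log k < k := by
      have := Real.log_le_sub_one_of_pos (by linarith : (0 : ℝ) < k)
      linarith
    have hcard : (Fintype.card (Fin v → Fin k) : ℝ) = Real.exp (v * Real.log k) := by
      rw [Real.exp_nat_mul, Real.exp_log (by linarith)]; simp
    calc (1 - Q⁻¹) ^ ⌊B⌋₊ * (Fintype.card (Fin v → Fin k) : ℝ)
        ≤ Real.exp (-Q⁻¹) ^ ⌊B⌋₊ * Real.exp (v * Real.log k) := by
          rw [hcard]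
          gcongr
          exact Real.one_sub_le_exp_neg _
      _ = Real.exp (v * Real.log k - Q⁻¹ * ⌊B⌋₊) := by
          rw [← Real.exp_nat_mul, ← Real.exp_add]; ring_nf
      _ < 1 := by
          rw [Real.exp_lt_one_iff]
          nlinarith
  have hempty := hE.trans_lt hsmall
  rw [Nat.cast_lt_one, Finset.card_eq_zero] at hempty
  intro χ
  by_contra hχ
  refine Finset.eq_empty_iff_forall_notMem.1 hempty χ ?_
  simp only [Finset.mem_filter]
  exact ⟨Finset.mem_univ χ, fun e he hmono => hχ ⟨e, he, hmono⟩⟩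
end

section
/- Let n ≥ 100 and q ≥ 1 be integers, and let 𝓗 be the collection of all n-uniform hypergraphs on [n²] with at most q hyperedges. Suppose M is a finite set and A: 𝓗 → M and f: M × 𝓗 → (two-colorings of [n²]) are functions such that for all H_A, H_B ∈ 𝓗, the coloring f(A(H_A), H_B) is valid for the hypergraph H_A ∪ H_B (its edge set being the union of the edge sets). Then ln |M| ≥ q²/(10·n²·2^n). -/
/-- **Weierstrass product inequality**. -/
theorem one_sub_sum_le_prod_one_sub {ι : Type*} {s : Finset ι} {f : ι → ℝ}
    (h0 : ∀ i ∈ s, 0 ≤ f i) (h1 : ∀ i ∈ s, f i ≤ 1) :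
    1 - ∑ i ∈ s, f i ≤ ∏ i ∈ s, (1 - f i) := by
  induction s using Finset.cons_induction with
  | empty => simp
  | cons a s ha ih =>
    rw [Finset.forall_mem_cons] at h0 h1
    have hle := ih h0.2 h1.2
    have hprod : ∏ i ∈ s, (1 - f i) ≤ 1 :=
      Finset.prod_le_one (fun i hi => sub_nonneg.2 (h1.2 i hi)) fun i hi => by
        linarith [h0.2 i hi]
    rw [Finset.sum_cons, Finset.prod_cons]
    nlinarith [h0.1]

/-- If `b ≤ a` and `a ^ q ≤ m * (a - b) ^ q`, then `q * (b / a) ≤ log m`. -/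
theorem mul_div_le_log_of_pow_le {a b m q : ℕ} (ha : 0 < a) (hba : b ≤ a)
    (h : a ^ q ≤ m * (a - b) ^ q) : (q : ℝ) * (b / a) ≤ Real.log m := by
  have ha' : (0 : ℝ) < a := by exact_mod_cast ha
  have h' : (a : ℝ) ^ q ≤ m * ((a : ℝ) - b) ^ q := by
    rw [← Nat.cast_sub hba]
    exact_mod_cast h
  have hsub : (a : ℝ) - b ≤ a * Real.exp (-(b / a)) := by
    have h1 := Real.add_one_le_exp (-((b : ℝ) / a))
    calc (a : ℝ) - b = a * (-(b / a) + 1) := by field_simp; ring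
      _ ≤ _ := by gcongr
  have hnn : (0 : ℝ) ≤ (a : ℝ) - b := by
    rw [sub_nonneg]; exact_mod_cast hba
  have h2 : (a : ℝ) ^ q * 1 ≤ a ^ q * (m * Real.exp (-(q * (b / a)))) := by
    calc (a : ℝ) ^ q * 1 ≤ m * ((a : ℝ) - b) ^ q := by simpa using h'
      _ ≤ m * (a * Real.exp (-(b / a))) ^ q := by gcongr
      _ = _ := by rw [mul_pow, ← Real.exp_nat_mul]; ring_nf
  have h3 : 1 ≤ m * Real.exp (-((q : ℝ) * (b / a))) :=
    le_of_mul_le_mul_left h2 (by positivity)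
  rw [Real.exp_neg, ← div_eq_mul_inv, one_le_div (Real.exp_pos _)] at h3
  rwa [Real.le_log_iff_exp_le (lt_of_lt_of_le (Real.exp_pos _) h3)]

/-- At least a `2⁻ⁿ / 2` fraction of the `n`-subsets of an `n²`-set lie in a given subset
containing at least half of the points. -/
theorem choose_sq_le_two_pow_mul_choose {n a : ℕ} (hn : 2 ≤ n) (ha : n ^ 2 ≤ 2 * a) :
    (n ^ 2).choose n ≤ 2 ^ (n + 1) * a.choose n := by
  have hreal : ((n ^ 2).descFactorial n : ℝ) ≤ 2 ^ (n + 1) * (a.descFactorial n : ℝ) := by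
    have hn' : (2 : ℝ) ≤ n := by exact_mod_cast hn
    have ha' : (n : ℝ) ^ 2 ≤ 2 * a := by exact_mod_cast ha
    have hcast : ∀ i ∈ Finset.range n, ((n ^ 2 - i : ℕ) : ℝ) = (n : ℝ) ^ 2 - i := by
      intro i hi
      rw [Finset.mem_range] at hi
      rw [Nat.cast_sub (by nlinarith)]
      push_cast; ring
    have hcast' : ∀ i ∈ Finset.range n, ((a - i : ℕ) : ℝ) = (a : ℝ) - i := by
      intro i hi
      rw [Finset.mem_range] at hi
      rw [Nat.cast_sub (by nlinarith)]
    rw [Nat.descFactorial_eq_prod_range, Nat.descFactorial_eq_prod_range, Nat.cast_prod,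
      Nat.cast_prod, Finset.prod_congr rfl hcast, Finset.prod_congr rfl hcast']
    have hD : (0 : ℝ) < n * (n - 1) := by nlinarith
    have hfac : ∀ i ∈ Finset.range n, (0 : ℝ) ≤ ((n : ℝ) ^ 2 - i) * (1 - i / (n * (n - 1))) ∧
        ((n : ℝ) ^ 2 - i) * (1 - i / (n * (n - 1))) ≤ 2 * ((a : ℝ) - i) := by
      intro i hi
      rw [Finset.mem_range] at hi
      have hi' : (i : ℝ) + 1 ≤ n := by exact_mod_cast hi
      have hi0 : (0 : ℝ) ≤ i := Nat.cast_nonneg i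
      have h1 : (i : ℝ) / (n * (n - 1)) ≤ 1 := by
        rw [div_le_one hD]; nlinarith
      have h2 : (i : ℝ) ≤ (n ^ 2 - i) * (i / (n * (n - 1))) := by
        rw [← mul_div_assoc, le_div_iff₀ hD]
        nlinarith
      refine ⟨mul_nonneg (by nlinarith) (by linarith), ?_⟩
      nlinarith
    have hsum : ∑ i ∈ Finset.range n, (i : ℝ) / (n * (n - 1)) = 1 / 2 := by
      rw [← Finset.sum_div, div_eq_iff hD.ne']
      have := Finset.sum_range_id_mul_two n
      have h2 : (∑ i ∈ Finset.range n, (i : ℝ)) * 2 = n * (n - 1) := by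
        rw [← Nat.cast_one (R := ℝ), ← Nat.cast_sub (by omega : 1 ≤ n)]
        rw [← Nat.cast_mul, ← this]
        push_cast; ring
      linarith
    have hw : (1 : ℝ) / 2 ≤ ∏ i ∈ Finset.range n, (1 - (i : ℝ) / (n * (n - 1))) := by
      have hle : ∀ i ∈ Finset.range n, (i : ℝ) / (n * (n - 1)) ≤ 1 := by
        intro i hi
        rw [Finset.mem_range] at hi
        have hi' : (i : ℝ) + 1 ≤ n := by exact_mod_cast hi
        rw [div_le_one hD]; nlinarith
      have := one_sub_sum_le_prod_one_sub (s := Finset.range n)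
        (f := fun i : ℕ => (i : ℝ) / (n * (n - 1))) (fun i _ => by positivity) hle
      linarith
    have hprod := Finset.prod_le_prod (fun i hi => (hfac i hi).1) (fun i hi => (hfac i hi).2)
    rw [Finset.prod_mul_distrib, Finset.prod_mul_distrib, Finset.prod_const,
      Finset.card_range] at hprod
    have hP : (0 : ℝ) ≤ ∏ i ∈ Finset.range n, ((n : ℝ) ^ 2 - i) := by
      refine Finset.prod_nonneg fun i hi => ?_
      rw [← hcast i hi]
      positivity
    have := mul_le_mul_of_nonneg_left hw hP
    rw [pow_succ (2 : ℝ) n]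
    linarith
  have hnat : (n ^ 2).descFactorial n ≤ 2 ^ (n + 1) * a.descFactorial n := by
    exact_mod_cast hreal
  rw [Nat.descFactorial_eq_factorial_mul_choose, Nat.descFactorial_eq_factorial_mul_choose] at hnat
  refine Nat.le_of_mul_le_mul_left ?_ n.factorial_pos
  linarith

/-- The `n`-subsets of `V` that are monochromatic under the coloring `c`. -/
def monochromaticEdges {V : Type*} [Fintype V] (n : ℕ) (c : V → Bool) :
    Finset (Finset V) :=
  {e ∈ Finset.powersetCard n Finset.univ | ∀ x ∈ e, ∀ y ∈ e, c x = c y}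

theorem mem_monochromaticEdges {V : Type*} [Fintype V] {n : ℕ} {c : V → Bool} {e : Finset V} :
    e ∈ monochromaticEdges n c ↔
      e ∈ Finset.powersetCard n Finset.univ ∧ ∀ x ∈ e, ∀ y ∈ e, c x = c y :=
  Finset.mem_filter

theorem choose_le_two_pow_mul_card_monochromaticEdges {n : ℕ} (hn : 2 ≤ n)
    (c : Fin (n ^ 2) → Bool) :
    (n ^ 2).choose n ≤ 2 ^ (n + 1) * (monochromaticEdges n c).card := by
  have hclass : ∀ b : Bool, (Finset.univ.filter fun x => c x = b).card.choose n ≤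
      (monochromaticEdges n c).card := by
    intro b
    rw [← Finset.card_powersetCard]
    refine Finset.card_le_card fun e he => ?_
    rw [Finset.mem_powersetCard] at he
    rw [mem_monochromaticEdges, Finset.mem_powersetCard]
    refine ⟨⟨Finset.subset_univ _, he.2⟩, fun x hx y hy => ?_⟩
    have hx := Finset.mem_filter.1 (he.1 hx)
    have hy := Finset.mem_filter.1 (he.1 hy)
    rw [hx.2, hy.2]
  have hsum : (Finset.univ.filter fun x => c x = true).card +
      (Finset.univ.filter fun x => c x = false).card = n ^ 2 := by
    have := Finset.card_filter_add_card_filter_not (s := Finset.univ) (fun x => c x = true)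
    simpa using this
  obtain ⟨b, hb⟩ : ∃ b : Bool, n ^ 2 ≤ 2 * (Finset.univ.filter fun x => c x = b).card := by
    by_contra! h
    have := h true
    have := h false
    omega
  exact (choose_sq_le_two_pow_mul_choose hn hb).trans (Nat.mul_le_mul_left _ (hclass b))

/-- If every sequence of `q` elements of `T` avoids one of the sets `K c ⊆ T`, each of size at
least `k`, then `|T| ^ q ≤ |C| * (|T| - k) ^ q`. -/
theorem card_pow_le_of_forall_exists_avoids {X C : Type*} [DecidableEq X] [Fintype C] {q k : ℕ}
    (T : Finset X) (K : C → Finset X) (hk : ∀ c, k ≤ (K c).card)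
    (h : ∀ s : Fin q → X, (∀ i, s i ∈ T) → ∃ c, K c ⊆ T ∧ ∀ i, s i ∉ K c) :
    T.card ^ q ≤ Fintype.card C * (T.card - k) ^ q := by
  classical
  have hsub : Fintype.piFinset (fun _ : Fin q => T) ⊆
      (Finset.univ.filter fun c => K c ⊆ T).biUnion
        fun c => Fintype.piFinset fun _ : Fin q => T \ K c := by
    intro s hs
    rw [Fintype.mem_piFinset] at hs
    obtain ⟨c, hc, hav⟩ := h s hs
    simp only [Finset.mem_biUnion, Fintype.mem_piFinset, Finset.mem_sdiff, Finset.mem_filter,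
      Finset.mem_univ, true_and]
    exact ⟨c, hc, fun i => ⟨hs i, hav i⟩⟩
  calc T.card ^ q = (Fintype.piFinset fun _ : Fin q => T).card := by simp
    _ ≤ _ := Finset.card_le_card hsub
    _ ≤ (Finset.univ.filter fun c => K c ⊆ T).card * (T.card - k) ^ q := by
      refine Finset.card_biUnion_le_card_mul _ _ _ fun c hc => ?_
      rw [Fintype.card_piFinset_const, Finset.card_sdiff_of_subset (Finset.mem_filter.1 hc).2]
      exact Nat.pow_le_pow_left (Nat.sub_le_sub_left (hk c) _) _
    _ ≤ _ := Nat.mul_le_mul_right _ (Finset.card_le_univ _)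

/-- Among `m` classes of sequences of `q` elements of `E`, some class `μ` has
`|E| ^ q ≤ m * |E \ T| ^ q` for each `T ⊆ E` avoided by all of its members. -/
theorem exists_fiber_card_pow_le {X M : Type*} [DecidableEq X] [Fintype M] [Nonempty M] {q : ℕ}
    (E : Finset X) (g : (Fin q → X) → M) :
    ∃ μ : M, ∀ T ⊆ E, (∀ s, (∀ i, s i ∈ E) → g s = μ → ∀ i, s i ∉ T) →
      E.card ^ q ≤ Fintype.card M * (E.card - T.card) ^ q := by
  classical
  by_contra! h
  choose T hTE hT hlt using h
  have hsub : Fintype.piFinset (fun _ : Fin q => E) ⊆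
      Finset.univ.biUnion fun μ => Fintype.piFinset fun _ : Fin q => E \ T μ := by
    intro s hs
    rw [Fintype.mem_piFinset] at hs
    simp only [Finset.mem_biUnion, Fintype.mem_piFinset, Finset.mem_sdiff, Finset.mem_univ,
      true_and]
    exact ⟨g s, fun i => ⟨hs i, hT _ s hs rfl i⟩⟩
  have hcard := (Finset.card_le_card hsub).trans Finset.card_biUnion_le
  simp only [Fintype.card_piFinset_const, Finset.card_sdiff_of_subset (hTE _)] at hcard
  have hsum : ∑ μ : M, Fintype.card M * (E.card - (T μ).card) ^ q < ∑ _μ : M, E.card ^ q :=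
    Finset.sum_lt_sum_of_nonempty Finset.univ_nonempty fun μ _ => hlt μ
  rw [← Finset.mul_sum, Finset.sum_const, Finset.card_univ, smul_eq_mul] at hsum
  exact absurd (Nat.mul_le_mul_left _ hcard) (not_le.2 hsum)

/-- **Theorem 4 (paper)**: any deterministic one-round two-player protocol for
two-coloring `n`-uniform hypergraphs on `[n²]` with at most `q` hyperedges requires
messages from a set `M` with `ln |M| ≥ q²/(10·n²·2^n)`. -/
theorem one_round_two_player_lower_bound
    (n q : ℕ) (hn : 100 ≤ n) (hq : 1 ≤ q)
    (M : Type) [Fintype M]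
    (A : Finset (Finset (Fin (n ^ 2))) → M)
    (f : M → Finset (Finset (Fin (n ^ 2))) → (Fin (n ^ 2) → Bool))
    (hvalid : ∀ HA HB : Finset (Finset (Fin (n ^ 2))),
      (∀ e ∈ HA, e.card = n) → HA.card ≤ q →
      (∀ e ∈ HB, e.card = n) → HB.card ≤ q →
      ∀ e ∈ HA ∪ HB, ∃ x ∈ e, ∃ y ∈ e, f (A HA) HB x ≠ f (A HA) HB y) :
    (q : ℝ) ^ 2 / (10 * (n : ℝ) ^ 2 * 2 ^ n) ≤ Real.log (Fintype.card M) := by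
  classical
  set E : Finset (Finset (Fin (n ^ 2))) := Finset.powersetCard n Finset.univ with hE
  have hEcard : E.card = (n ^ 2).choose n := by simp [hE]
  have hEpos : 0 < E.card := by
    rw [hEcard]
    exact Nat.choose_pos (by nlinarith)
  let H : (Fin q → Finset (Fin (n ^ 2))) → Finset (Finset (Fin (n ^ 2))) :=
    fun s => Finset.univ.image s
  have hHcard : ∀ s, (H s).card ≤ q := fun s => Finset.card_image_le.trans (by simp)
  have hHunif : ∀ s, (∀ i, s i ∈ E) → ∀ e ∈ H s, e.card = n := by
    intro s hs e he
    obtain ⟨i, -, rfl⟩ := Finset.mem_image.1 he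
    exact (Finset.mem_powersetCard.1 (hs i)).2
  have hHmem : ∀ s i, s i ∈ H s := fun s i => Finset.mem_image_of_mem s (Finset.mem_univ i)
  have hnotmono : ∀ s t, (∀ i, s i ∈ E) → (∀ i, t i ∈ E) → ∀ e ∈ H s ∪ H t,
      e ∉ monochromaticEdges n (f (A (H s)) (H t)) := by
    intro s t hs ht e he hmono
    obtain ⟨x, hx, y, hy, hxy⟩ :=
      hvalid (H s) (H t) (hHunif s hs) (hHcard s) (hHunif t ht) (hHcard t) e he
    exact hxy ((mem_monochromaticEdges.1 hmono).2 x hx y hy)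
  have : Nonempty M := ⟨A ∅⟩
  obtain ⟨μ, hμ⟩ := exists_fiber_card_pow_le (q := q) E fun s => A (H s)
  set T : Finset (Finset (Fin (n ^ 2))) :=
    {e ∈ E | ∃ t : Fin q → Finset (Fin (n ^ 2)), (∀ i, t i ∈ E) ∧
      e ∈ monochromaticEdges n (f μ (H t))} with hT
  have hTE : T ⊆ E := Finset.filter_subset _ _
  have hKT : ∀ t, (∀ i, t i ∈ E) → monochromaticEdges n (f μ (H t)) ⊆ T := fun t ht e he =>
    Finset.mem_filter.2 ⟨(mem_monochromaticEdges.1 he).1, t, ht, he⟩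
  have hmsg := mul_div_le_log_of_pow_le hEpos (Finset.card_le_card hTE) <| hμ T hTE <| by
    rintro s hs rfl i hi
    obtain ⟨-, t, ht, hmono⟩ := Finset.mem_filter.1 hi
    exact hnotmono s t hs ht _ (Finset.mem_union_left _ (hHmem s i)) hmono
  obtain ⟨k, hk, hEk⟩ : ∃ k, (∀ c : Fin (n ^ 2) → Bool, k ≤ (monochromaticEdges n c).card) ∧
      E.card ≤ 2 ^ (n + 1) * k := by
    obtain ⟨c, hc⟩ := Finite.exists_min
      fun c : Fin (n ^ 2) → Bool => (monochromaticEdges n c).card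
    exact ⟨_, hc, hEcard ▸ choose_le_two_pow_mul_card_monochromaticEdges (by omega) c⟩
  have hkpos : 0 < k := Nat.pos_of_ne_zero fun h => by rw [h] at hEk; omega
  obtain ⟨s₀, hs₀, rfl⟩ : ∃ s, (∀ i, s i ∈ E) ∧ A (H s) = μ := by
    by_contra! hempty
    have := hμ E subset_rfl fun s hs h => absurd h (hempty s hs)
    rw [Nat.sub_self, zero_pow (by omega), mul_zero] at this
    exact absurd this (not_le.2 (pow_pos hEpos q))
  have hkT : k ≤ T.card := (hk _).trans (Finset.card_le_card (hKT s₀ hs₀))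
  have hTpos : 0 < T.card := hkpos.trans_le hkT
  have hcolorings := mul_div_le_log_of_pow_le hTpos hkT <|
    card_pow_le_of_forall_exists_avoids (q := q) T
      (fun c : Fin (n ^ 2) → Bool => monochromaticEdges n c) hk fun s hs =>
        ⟨f (A (H s₀)) (H s), hKT s fun i => hTE (hs i), fun i =>
          hnotmono s₀ s hs₀ (fun i => hTE (hs i)) _ (Finset.mem_union_right _ (hHmem s i))⟩
  have hlog : Real.log (Fintype.card (Fin (n ^ 2) → Bool)) ≤ (n : ℝ) ^ 2 := by
    rw [Fintype.card_fun, Fintype.card_bool, Fintype.card_fin, Nat.cast_pow, Real.log_pow,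
      Nat.cast_pow]
    have : Real.log (2 : ℕ) ≤ 1 := by
      have := Real.log_two_lt_d9
      push_cast
      linarith
    exact mul_le_of_le_one_right (by positivity) this
  refine le_trans ?_ hmsg
  have hE' : (0 : ℝ) < E.card := by exact_mod_cast hEpos
  have hT' : (0 : ℝ) < T.card := by exact_mod_cast hTpos
  have hn' : (0 : ℝ) < n := by exact_mod_cast (by omega : 0 < n)
  have hkE : (E.card : ℝ) ≤ 2 * 2 ^ n * k := by
    rw [← pow_succ']
    exact_mod_cast hEk
  have hqk : (q : ℝ) * k ≤ n ^ 2 * T.card := by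
    have := hcolorings.trans hlog
    rwa [← mul_div_assoc, div_le_iff₀ hT'] at this
  rw [← mul_div_assoc, div_le_div_iff₀ (by positivity) hE']
  calc (q : ℝ) ^ 2 * (E.card : ℝ) ≤ (q : ℝ) ^ 2 * (2 * 2 ^ n * k) := by gcongr
    _ = 2 * 2 ^ n * (q : ℝ) * (q * k) := by ring
    _ ≤ 2 * 2 ^ n * (q : ℝ) * ((n : ℝ) ^ 2 * (T.card : ℝ)) := by gcongr
    _ ≤ 10 * 2 ^ n * (q : ℝ) * ((n : ℝ) ^ 2 * (T.card : ℝ)) := by gcongr; norm_num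
    _ = _ := by ring
end

section
/- There is an absolute constant c > 0 such that the following holds. Let n ≥ 2, k ≥ 1, v ≥ 1 and q ≥ 1 be integers, and let 𝓗 be the collection of all n-uniform hypergraphs on [v] with at most q hyperedges. Suppose M_1, …, M_k are nonempty finite sets and g_1: 𝓗 → M_1, g_i: 𝓗 × M_{i−1} → M_i (for 2 ≤ i ≤ k), and g_{k+1}: 𝓗 × M_k → (two-colorings of [v]) are functions such that for all (H_1, …, H_{k+1}) ∈ 𝓗^{k+1}, the coloring g_{k+1}(H_{k+1}, m_k) is valid for H_1 ∪ H_2 ∪ ⋯ ∪ H_{k+1}, where m_1 = g_1(H_1) and m_i = g_i(H_i, m_{i−1}) for 2 ≤ i ≤ k. Then max_{1 ≤ i ≤ k} log₂ |M_i| ≥ c · q · ((q/v) · C(⌈v/2⌉, n)/C(v, n))^{1/k}. -/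
/-- The chain of messages in a sequential one-round multi-player protocol:
player `0` (holding input `H 0`) sends `g1 (H 0) : M 0`, and for `i ≥ 1` player `i`
(holding `H i`) computes its message `msgChain … i : M i` from the previous message
via `g`. -/
def msgChain {HG : Type} {M : ℕ → Type} (g1 : HG → M 0)
    (g : (i : ℕ) → HG → M i → M (i + 1)) (H : ℕ → HG) : (i : ℕ) → M i
  | 0 => g1 (H 0)
  | (i + 1) => g i (H (i + 1)) (msgChain g1 g H i)

open Finset in
/-- If every subset of `G` with at most `q` elements is given a label in `ι`, then the subsets
sharing some label cover at least a `1 - log |ι| / q` fraction of `G`. -/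
theorem exists_label_covering {α ι : Type} [DecidableEq α] [Fintype ι] (G : Finset α)
    {q : ℕ} (hq : 1 ≤ q) (f : Finset α → ι) :
    ∃ H₀ ⊆ G, #H₀ ≤ q ∧ ∃ U ⊆ G, (#G : ℝ) * (1 - Real.log (Fintype.card ι) / q) ≤ #U ∧
      ∀ e ∈ U, ∃ H ⊆ G, #H ≤ q ∧ f H = f H₀ ∧ e ∈ H := by
  classical
  rcases G.eq_empty_or_nonempty with rfl | hG
  · exact ⟨∅, by simp, by simp, ∅, by simp, by simp, by simp⟩
  let U : ι → Finset α := fun i ↦ {e ∈ G | ∃ H ⊆ G, #H ≤ q ∧ f H = i ∧ e ∈ H}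
  let P : Finset (Fin q → α) := Fintype.piFinset fun _ ↦ G
  let φ : (Fin q → α) → ι := fun s ↦ f (univ.image s)
  have hP : ∀ s ∈ P, univ.image s ⊆ G ∧ #(univ.image s) ≤ q := by
    intro s hs
    refine ⟨?_, card_image_le.trans (by simp)⟩
    intro e he
    obtain ⟨j, -, rfl⟩ := mem_image.1 he
    exact Fintype.mem_piFinset.1 hs j
  have hι : (0 : ℝ) < Fintype.card ι := by
    exact_mod_cast Fintype.card_pos_iff.2 ⟨f ∅⟩
  have hg : (0 : ℝ) < #G := by exact_mod_cast hG.card_pos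
  have hq' : (0 : ℝ) < q := by exact_mod_cast hq
  suffices h : ∃ s ∈ P, (#G : ℝ) * (1 - Real.log (Fintype.card ι) / q) ≤ #(U (φ s)) by
    obtain ⟨s, hs, h⟩ := h
    exact ⟨_, (hP s hs).1, (hP s hs).2, U (φ s), filter_subset _ _, h,
      fun e he ↦ (mem_filter.1 he).2⟩
  by_contra! hlt
  have hfib : ∀ i ∈ P.image φ, (#{s ∈ P | φ s = i} : ℝ) < #G ^ q / Fintype.card ι := by
    intro i hi
    obtain ⟨s, hs, rfl⟩ := mem_image.1 hi
    have hsub : {t ∈ P | φ t = φ s} ⊆ Fintype.piFinset fun _ : Fin q ↦ U (φ s) := by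
      intro t ht
      rw [mem_filter] at ht
      rw [Fintype.mem_piFinset]
      intro j
      exact mem_filter.2 ⟨Fintype.mem_piFinset.1 ht.1 j, _, (hP t ht.1).1, (hP t ht.1).2, ht.2,
        mem_image_of_mem _ (mem_univ j)⟩
    have hcard : (#{t ∈ P | φ t = φ s} : ℝ) ≤ (#(U (φ s)) : ℝ) ^ q := by
      exact_mod_cast (card_le_card hsub).trans (by simp)
    have hexp : (#(U (φ s)) : ℝ) < #G * Real.exp (-(Real.log (Fintype.card ι) / q)) :=
      (hlt s hs).trans_le <| by
        gcongr
        linarith [Real.add_one_le_exp (-(Real.log (Fintype.card ι) / q))]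
    calc (#{t ∈ P | φ t = φ s} : ℝ) ≤ (#(U (φ s)) : ℝ) ^ q := hcard
      _ < (#G * Real.exp (-(Real.log (Fintype.card ι) / q))) ^ q :=
        pow_lt_pow_left₀ hexp (by positivity) (by omega)
      _ = #G ^ q / Fintype.card ι := by
        rw [mul_pow, ← Real.exp_nat_mul, mul_neg, mul_div_cancel₀ _ hq'.ne', Real.exp_neg,
          Real.exp_log hι, div_eq_mul_inv]
  have hne : (P.image φ).Nonempty :=
    (Fintype.piFinset_nonempty.2 fun _ ↦ hG).image φ
  have hsum := sum_lt_sum_of_nonempty hne hfib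
  have htot : (∑ i ∈ P.image φ, (#{s ∈ P | φ s = i} : ℝ)) = (#G : ℝ) ^ q := by
    rw [← Nat.cast_sum, ← card_eq_sum_card_image]
    simp [P]
  rw [htot, sum_const, nsmul_eq_mul] at hsum
  have hle : (#(P.image φ) : ℝ) * (#G ^ q / Fintype.card ι) ≤ #G ^ q := by
    rw [← mul_div_assoc, div_le_iff₀ hι, mul_comm]
    gcongr
    exact card_le_univ _
  linarith

open Finset in
/-- Every two-coloring of `v` points has at least `C(⌈v/2⌉, n)` monochromatic `n`-sets. -/
theorem choose_le_card_monochromatic_s10 {v : ℕ} (n : ℕ) (χ : Fin v → Bool) :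
    ((v + 1) / 2).choose n ≤
      #{e ∈ powersetCard n (univ : Finset (Fin v)) | ∀ x ∈ e, ∀ y ∈ e, χ x = χ y} := by
  have hsplit := card_filter_add_card_filter_not (s := (univ : Finset (Fin v))) (χ · = true)
  rw [card_univ, Fintype.card_fin] at hsplit
  obtain ⟨b, hb⟩ : ∃ b, (v + 1) / 2 ≤ #{x : Fin v | χ x = b} := by
    by_contra! h
    have h₁ := h true
    have h₂ := h false
    simp only [Bool.not_eq_true] at hsplit
    omega
  calc ((v + 1) / 2).choose n ≤ (#{x : Fin v | χ x = b}).choose n := Nat.choose_le_choose n hb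
    _ = #(powersetCard n {x : Fin v | χ x = b}) := (card_powersetCard _ _).symm
    _ ≤ _ := card_le_card fun e he ↦ by
      rw [mem_powersetCard] at he
      refine mem_filter.2 ⟨mem_powersetCard.2 ⟨subset_univ _, he.2⟩, fun x hx y hy ↦ ?_⟩
      rw [(mem_filter.1 (he.1 hx)).2, (mem_filter.1 (he.1 hy)).2]

theorem msgChain_congr {HG : Type} {M : ℕ → Type} (g1 : HG → M 0)
    (g : (i : ℕ) → HG → M i → M (i + 1)) {H H' : ℕ → HG} {i : ℕ} (h : ∀ j ≤ i, H j = H' j) :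
    msgChain g1 g H i = msgChain g1 g H' i := by
  induction i with
  | zero => simp [msgChain, h 0 le_rfl]
  | succ i ih => simp [msgChain, h (i + 1) le_rfl, ih fun j hj ↦ h j (by omega)]

/-- `H` is an `n`-uniform hypergraph with at most `q` hyperedges. -/
def IsSmallUniform {v : ℕ} (n q : ℕ) (H : Finset (Finset (Fin v))) : Prop :=
  (∀ e ∈ H, e.card = n) ∧ H.card ≤ q

open Finset in
/-- If all message sets have `log |M i| ≤ ℓ`, then after `i + 1` players there is a reachable
message for which all but a `(ℓ / q) ^ (i + 1)` fraction of the `n`-sets may already have been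
held by one of the players. -/
theorem exists_message_few_unseen {v n q k : ℕ} (hq : 1 ≤ q) {M : ℕ → Type}
    [∀ i, Fintype (M i)] (g1 : Finset (Finset (Fin v)) → M 0)
    (g : (i : ℕ) → Finset (Finset (Fin v)) → M i → M (i + 1)) {ℓ : ℝ} (hℓ : 0 ≤ ℓ)
    (hM : ∀ i < k, Real.log (Fintype.card (M i)) ≤ ℓ) (i : ℕ) (hi : i < k) :
    ∃ (m : M i) (G : Finset (Finset (Fin v))), G ⊆ powersetCard n univ ∧
      (#G : ℝ) ≤ v.choose n * (ℓ / q) ^ (i + 1) ∧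
      (∃ H : ℕ → Finset (Finset (Fin v)), (∀ j, IsSmallUniform n q (H j)) ∧
        msgChain g1 g H i = m) ∧
      ∀ e ∈ powersetCard n univ, e ∉ G → ∃ H : ℕ → Finset (Finset (Fin v)),
        (∀ j, IsSmallUniform n q (H j)) ∧ msgChain g1 g H i = m ∧ ∃ j ≤ i, e ∈ H j := by
  have small {G H : Finset (Finset (Fin v))} (hG : G ⊆ powersetCard n univ) (hH : H ⊆ G)
      (hc : #H ≤ q) : IsSmallUniform n q H :=
    ⟨fun e he ↦ (mem_powersetCard.1 (hG (hH he))).2, hc⟩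
  have shrink {i : ℕ} (hi : i < k) {G U : Finset (Finset (Fin v))} (hU : U ⊆ G)
      (h : (#G : ℝ) * (1 - Real.log (Fintype.card (M i)) / q) ≤ #U) :
      (#(G \ U) : ℝ) ≤ #G * (ℓ / q) := by
    rw [card_sdiff_of_subset hU, Nat.cast_sub (card_le_card hU)]
    have : (#G : ℝ) * (Real.log (Fintype.card (M i)) / q) ≤ #G * (ℓ / q) := by
      gcongr
      exact hM i hi
    linarith
  induction i with
  | zero =>
    obtain ⟨H₀, hH₀, hc₀, U, hU, hcard, hcov⟩ :=
      exists_label_covering (powersetCard n (univ : Finset (Fin v))) hq g1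
    refine ⟨g1 H₀, powersetCard n univ \ U, sdiff_subset, ?_,
      ⟨fun _ ↦ H₀, fun _ ↦ small Subset.rfl hH₀ hc₀, rfl⟩, fun e he heG ↦ ?_⟩
    · simpa using shrink hi hU hcard
    · obtain ⟨H, hH, hc, hm, heH⟩ := hcov e (by simpa [he] using heG)
      exact ⟨fun _ ↦ H, fun _ ↦ small Subset.rfl hH hc, hm, 0, le_rfl, heH⟩
  | succ i ih =>
    obtain ⟨m, G, hG, hGcard, ⟨K, hK, hKm⟩, hseen⟩ := ih (by omega)
    obtain ⟨H₀, hH₀, hc₀, U, hU, hcard, hcov⟩ := exists_label_covering G hq fun H ↦ g i H m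
    have extend {K : ℕ → Finset (Finset (Fin v))} {H : Finset (Finset (Fin v))}
        (hK : ∀ j, IsSmallUniform n q (K j)) (hKm : msgChain g1 g K i = m)
        (hH : IsSmallUniform n q H) :
        (∀ j, IsSmallUniform n q (Function.update K (i + 1) H j)) ∧
          msgChain g1 g (Function.update K (i + 1) H) (i + 1) = g i H m := by
      refine ⟨fun j ↦ ?_, ?_⟩
      · by_cases hj : j = i + 1
        · subst hj
          simpa using hH
        · simpa [hj] using hK j
      · have : msgChain g1 g (Function.update K (i + 1) H) i = m :=
          (msgChain_congr g1 g fun j hj ↦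
            Function.update_of_ne (show j ≠ i + 1 by omega) _ _).trans hKm
        simp [msgChain, this]
    obtain ⟨hK₀, hKm₀⟩ := extend hK hKm (small hG hH₀ hc₀)
    refine ⟨g i H₀ m, G \ U, sdiff_subset.trans hG, ?_, ⟨_, hK₀, hKm₀⟩, fun e he heG ↦ ?_⟩
    · calc (#(G \ U) : ℝ) ≤ #G * (ℓ / q) := shrink hi hU hcard
        _ ≤ v.choose n * (ℓ / q) ^ (i + 1) * (ℓ / q) := by gcongr
        _ = _ := by ring
    · by_cases heU : e ∈ U
      · obtain ⟨H, hH, hc, hm, heH⟩ := hcov e heU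
        obtain ⟨hK', hKm'⟩ := extend hK hKm (small hG hH hc)
        exact ⟨_, hK', hKm'.trans hm, i + 1, le_rfl, by simpa using heH⟩
      · obtain ⟨K', hK', hKm', j, hj, hej⟩ :=
          hseen e he fun h ↦ heG (mem_sdiff.2 ⟨h, heU⟩)
        obtain ⟨h₁, h₂⟩ := extend hK' hKm' (small hG hH₀ hc₀)
        refine ⟨_, h₁, h₂, j, by omega, ?_⟩
        rwa [Function.update_of_ne (by omega)]

/-- **Theorem 5 (paper)**: there is an absolute constant `c > 0` such that in any
deterministic one-round `(k+1)`-player sequential protocol for two-coloring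
`n`-uniform hypergraphs on `[v]` with at most `q` hyperedges each, some player must
send a message from a set `M i` with
`log₂ |M i| ≥ c · q · ((q/v) · C(⌈v/2⌉,n)/C(v,n))^(1/k)`. -/
theorem multi_player_lower_bound :
    ∃ c : ℝ, 0 < c ∧
      ∀ (n k v q : ℕ), 2 ≤ n → 1 ≤ k → 1 ≤ v → 1 ≤ q →
      ∀ (M : ℕ → Type) [∀ i, Fintype (M i)] [∀ i, Nonempty (M i)]
        (g1 : Finset (Finset (Fin v)) → M 0)
        (g : (i : ℕ) → Finset (Finset (Fin v)) → M i → M (i + 1))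
        (gout : Finset (Finset (Fin v)) → M (k - 1) → (Fin v → Bool)),
        (∀ H : ℕ → Finset (Finset (Fin v)),
          (∀ i, (∀ e ∈ H i, e.card = n) ∧ (H i).card ≤ q) →
          ∀ e ∈ (Finset.range (k + 1)).biUnion H, ∃ x ∈ e, ∃ y ∈ e,
            gout (H k) (msgChain g1 g H (k - 1)) x ≠
              gout (H k) (msgChain g1 g H (k - 1)) y) →
        ∃ i < k, c * q * (((q : ℝ) / v) *
            ((((v + 1) / 2).choose n : ℝ) / (v.choose n))) ^ ((1 : ℝ) / k) ≤
          Real.logb 2 (Fintype.card (M i)) := by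
  classical
  refine ⟨1, one_pos, fun n k v q _ hk hv hq M _ _ g1 g gout hvalid ↦ ?_⟩
  by_contra! hlt
  set X : ℝ := ((q : ℝ) / v) * ((((v + 1) / 2).choose n : ℝ) / (v.choose n)) with hX
  have hX0 : 0 ≤ X := by positivity
  have hv' : (0 : ℝ) < v := by exact_mod_cast hv
  have hq' : (0 : ℝ) < q := by exact_mod_cast hq
  have hlogb (i : ℕ) : 0 ≤ Real.logb 2 (Fintype.card (M i)) :=
    Real.logb_nonneg one_lt_two (by exact_mod_cast Fintype.card_pos)
  have hXpos : 0 < X := by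
    refine hX0.lt_of_ne' fun h ↦ ?_
    have := (hlogb 0).trans_lt (hlt 0 (by omega))
    rw [h, Real.zero_rpow (by positivity), mul_zero] at this
    exact this.false
  have hA : ((v + 1) / 2).choose n ≠ 0 := fun h ↦ by simp [hX, h] at hXpos
  have hT : v.choose n ≠ 0 := fun h ↦ by simp [hX, h] at hXpos
  have hM : ∀ i < k, Real.log (Fintype.card (M i)) ≤ q * X ^ ((1 : ℝ) / k) := by
    intro i hi
    have h := hlt i hi
    have h₂ : Real.log (Fintype.card (M i)) ≤ Real.logb 2 (Fintype.card (M i)) := by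
      rw [Real.logb, le_div_iff₀ (Real.log_pos one_lt_two)]
      exact mul_le_of_le_one_right (Real.log_natCast_nonneg _) (by linarith [Real.log_two_lt_d9])
    linarith
  obtain ⟨m, G, hG, hGcard, ⟨K, hK, hKm⟩, hseen⟩ :=
    exists_message_few_unseen (n := n) hq g1 g (by positivity) hM (k - 1) (by omega)
  have hGcard' : (G.card : ℝ) * v ≤ q * ((v + 1) / 2).choose n := by
    rw [mul_div_cancel_left₀ _ hq'.ne', Nat.sub_add_cancel hk, one_div,
      Real.rpow_inv_natCast_pow hX0 (by omega)] at hGcard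
    have : (v.choose n : ℝ) ≠ 0 := by exact_mod_cast hT
    calc (G.card : ℝ) * v ≤ v.choose n * X * v := by gcongr
      _ = _ := by rw [hX]; field_simp
  have proper {K : ℕ → Finset (Finset (Fin v))} {H : Finset (Finset (Fin v))}
      (hK : ∀ j, IsSmallUniform n q (K j)) (hKm : msgChain g1 g K (k - 1) = m)
      (hH : IsSmallUniform n q H) {e : Finset (Fin v)} (he : e ∈ H ∨ ∃ j ≤ k - 1, e ∈ K j) :
      ∃ x ∈ e, ∃ y ∈ e, gout H m x ≠ gout H m y := by
    have hmsg : msgChain g1 g (Function.update K k H) (k - 1) = m :=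
      (msgChain_congr g1 g fun j hj ↦ Function.update_of_ne (show j ≠ k by omega) _ _).trans hKm
    have h := hvalid (Function.update K k H) (fun j ↦ ?_) e ?_
    · simpa [hmsg] using h
    · by_cases hj : j = k
      · subst hj
        simpa [IsSmallUniform] using hH
      · simpa [hj, IsSmallUniform] using hK j
    · rw [Finset.mem_biUnion]
      rcases he with he | ⟨j, hj, he⟩
      · exact ⟨k, by simp, by simpa using he⟩
      · refine ⟨j, Finset.mem_range.2 (by omega), ?_⟩
        rwa [Function.update_of_ne (by omega)]
  obtain ⟨H₀, hH₀, hc₀, U, hU, hcard, hcov⟩ :=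
    exists_label_covering G hq fun H ↦ gout H m
  have small {H : Finset (Finset (Fin v))} (hH : H ⊆ G) (hc : H.card ≤ q) :
      IsSmallUniform n q H :=
    ⟨fun e he ↦ (Finset.mem_powersetCard.1 (hG (hH he))).2, hc⟩
  have hmono : ((v + 1) / 2).choose n ≤ (G \ U).card := by
    refine (choose_le_card_monochromatic_s10 n (gout H₀ m)).trans (Finset.card_le_card fun e he ↦ ?_)
    obtain ⟨he, hemono⟩ := Finset.mem_filter.1 he
    rw [Finset.mem_sdiff]
    constructor
    · by_contra heG
      obtain ⟨K', hK', hKm', hj⟩ := hseen e he heG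
      obtain ⟨x, hx, y, hy, hxy⟩ := proper hK' hKm' (small hH₀ hc₀) (.inr hj)
      exact hxy (hemono x hx y hy)
    · intro heU
      obtain ⟨H, hH, hc, hm, heH⟩ := hcov e heU
      obtain ⟨x, hx, y, hy, hxy⟩ := proper hK hKm (small hH hc) (.inl heH)
      rw [show gout H m = gout H₀ m from hm] at hxy
      exact hxy (hemono x hx y hy)
  have hmono' : (((v + 1) / 2).choose n : ℝ) ≤ G.card - U.card := by
    rw [← Nat.cast_sub (Finset.card_le_card hU), ← Finset.card_sdiff_of_subset hU]
    exact_mod_cast hmono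
  have hlog : Real.log (Fintype.card (Fin v → Bool)) = v * Real.log 2 := by simp
  rw [hlog] at hcard
  have hA' : (0 : ℝ) < ((v + 1) / 2).choose n := by
    exact_mod_cast Nat.pos_of_ne_zero hA
  have hbound : (((v + 1) / 2).choose n : ℝ) ≤ (G.card * v) * Real.log 2 / q := by
    have : (G.card : ℝ) * (1 - v * Real.log 2 / q)
        = G.card - (G.card * v) * Real.log 2 / q := by ring
    linarith
  rw [le_div_iff₀ hq'] at hbound
  have h₁ := mul_le_mul_of_nonneg_right hGcard' (Real.log_pos one_lt_two).le
  have h₂ := mul_pos hq' hA'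
  nlinarith [Real.log_two_lt_d9]
end

section
/- There is an absolute constant c > 0 such that the following holds for every integer n ≥ 100 and every integer q ≥ 1. Let S be a finite set (the states), σ₀ ∈ S, δ: S × (n-element subsets of [n²]) → S a transition function, and out: S → (two-colorings of [n²]) an output function. Suppose that for every sequence e_1, …, e_m of n-element subsets of [n²] with m ≤ q, the coloring out(δ(⋯δ(δ(σ₀, e_1), e_2)⋯, e_m)) is valid for the hypergraph with edge set {e_1, …, e_m}. Then log₂ |S| ≥ c · q / n. -/
/-- Among the streams of `m` letters of `V`, with `2 ^ m` exceeding the number of states, some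
final state is shared by streams which together use at least half of the letters of `V`. -/
theorem exists_state_forall_mem_stream {S α : Type*} [Fintype S]
    (δ : S → α → S) (σ : S) (V : Finset α) (hV : V.Nonempty) (m : ℕ)
    (hm : Fintype.card S < 2 ^ m) :
    ∃ σ' : S, ∃ U ⊆ V, V.card ≤ 2 * U.card ∧
      ∀ e ∈ U, ∃ l : List α, (∀ a ∈ l, a ∈ V) ∧ l.length = m ∧ l.foldl δ σ = σ' ∧ e ∈ l := by
  classical
  let F : S → Finset (Fin m → α) := fun σ' =>
    (Fintype.piFinset fun _ : Fin m => V).filter fun f => (List.ofFn f).foldl δ σ = σ'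
  let U : S → Finset α := fun σ' => V.filter fun e => ∃ f ∈ F σ', ∃ j, f j = e
  by_contra! hcon
  have hU : ∀ σ', 2 * (U σ').card ≤ V.card := by
    intro σ'
    by_contra! hlt
    obtain ⟨e, he, hne⟩ := hcon σ' (U σ') (Finset.filter_subset _ _) hlt.le
    obtain ⟨-, f, hf, j, rfl⟩ := Finset.mem_filter.mp he
    obtain ⟨hfV, hfσ⟩ := Finset.mem_filter.mp hf
    rw [Fintype.mem_piFinset] at hfV
    refine hne (List.ofFn f) ?_ (by simp) hfσ (by simp)
    intro a ha
    obtain ⟨i, rfl⟩ := List.mem_ofFn.mp ha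
    exact hfV i
  have hF : ∀ σ', (F σ').card ≤ (U σ').card ^ m := by
    intro σ'
    rw [← Fintype.card_piFinset_const]
    refine Finset.card_le_card fun f hf => ?_
    rw [Fintype.mem_piFinset]
    have hfV := Fintype.mem_piFinset.mp (Finset.mem_filter.mp hf).1
    exact fun j => Finset.mem_filter.mpr ⟨hfV j, f, hf, j, rfl⟩
  have hsum : V.card ^ m = ∑ σ', (F σ').card := by
    rw [← Fintype.card_piFinset_const]
    exact Finset.card_eq_sum_card_fiberwise fun _ _ => Finset.mem_coe.mpr (Finset.mem_univ _)
  have hle : 2 ^ m * V.card ^ m ≤ Fintype.card S * V.card ^ m := by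
    rw [hsum, Finset.mul_sum, ← hsum, ← smul_eq_mul, ← Finset.card_univ, ← Finset.sum_const]
    refine Finset.sum_le_sum fun σ' _ => ?_
    calc 2 ^ m * (F σ').card ≤ 2 ^ m * (U σ').card ^ m := Nat.mul_le_mul_left _ (hF σ')
      _ = (2 * (U σ').card) ^ m := (mul_pow _ _ _).symm
      _ ≤ V.card ^ m := Nat.pow_le_pow_left (hU σ') m
  exact absurd (Nat.le_of_mul_le_mul_right hle (pow_pos hV.card_pos m)) (not_le.mpr hm)

/-- After `i` batches of at most `m` letters of `E`, some state is reachable by streams that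
together use all letters of `E` outside a set `V` with `2 ^ i * #V ≤ #E`. -/
theorem exists_state_few_unused {S α : Type*} [Fintype S] [DecidableEq α]
    (δ : S → α → S) (σ₀ : S) (E : Finset α) (m : ℕ) (hm : Fintype.card S < 2 ^ m) (i : ℕ) :
    ∃ σ : S, ∃ V ⊆ E, 2 ^ i * V.card ≤ E.card ∧
      (∃ l : List α, (∀ a ∈ l, a ∈ E) ∧ l.length ≤ i * m ∧ l.foldl δ σ₀ = σ) ∧
      ∀ e ∈ E \ V, ∃ l : List α,
        (∀ a ∈ l, a ∈ E) ∧ l.length ≤ i * m ∧ l.foldl δ σ₀ = σ ∧ e ∈ l := by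
  induction i with
  | zero => exact ⟨σ₀, E, subset_rfl, by simp, ⟨[], by simp⟩, by simp⟩
  | succ i ih =>
    obtain ⟨σ, V, hVE, hcard, ⟨p, hpE, hpl, hpσ⟩, hused⟩ := ih
    have hlen : i * m ≤ (i + 1) * m := Nat.mul_le_mul_right m (Nat.le_succ i)
    rcases V.eq_empty_or_nonempty with rfl | hV
    · refine ⟨σ, ∅, hVE, by simp, ⟨p, hpE, hpl.trans hlen, hpσ⟩, fun e he => ?_⟩
      obtain ⟨l, hlE, hll, h⟩ := hused e he
      exact ⟨l, hlE, hll.trans hlen, h⟩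
    obtain ⟨σ', U, hUV, hUcard, hU⟩ := exists_state_forall_mem_stream δ σ V hV m hm
    have hUne : U.Nonempty := by
      rw [← Finset.card_pos]
      have := hV.card_pos
      omega
    have append : ∀ l t : List α, (∀ a ∈ l, a ∈ E) → l.length ≤ i * m → l.foldl δ σ₀ = σ →
        (∀ a ∈ t, a ∈ V) → t.length = m → t.foldl δ σ = σ' →
        (∀ a ∈ l ++ t, a ∈ E) ∧ (l ++ t).length ≤ (i + 1) * m ∧ (l ++ t).foldl δ σ₀ = σ' := by
      intro l t hlE hll hlσ htV htl htσ
      refine ⟨fun a ha => ?_, ?_, ?_⟩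
      · exact (List.mem_append.mp ha).elim (hlE a) fun h => hVE (htV a h)
      · rw [List.length_append, htl, add_one_mul]
        exact Nat.add_le_add_right hll m
      · rw [List.foldl_append, hlσ, htσ]
    obtain ⟨u, hu⟩ := hUne
    obtain ⟨t, htV, htl, htσ, -⟩ := hU u hu
    refine ⟨σ', V \ U, Finset.sdiff_subset.trans hVE, ?_, ⟨p ++ t, append p t hpE hpl hpσ htV htl htσ⟩,
      fun e he => ?_⟩
    · have h := Finset.card_sdiff_add_card_eq_card hUV
      calc 2 ^ (i + 1) * (V \ U).card = 2 ^ i * (2 * (V \ U).card) := by ring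
        _ ≤ 2 ^ i * V.card := Nat.mul_le_mul_left _ (by omega)
        _ ≤ E.card := hcard
    · obtain ⟨heE, heVU⟩ := Finset.mem_sdiff.mp he
      by_cases heV : e ∈ V
      · have heU : e ∈ U := by
          by_contra h
          exact heVU (Finset.mem_sdiff.mpr ⟨heV, h⟩)
        obtain ⟨t', htV', htl', htσ', het⟩ := hU e heU
        obtain ⟨h₁, h₂, h₃⟩ := append p t' hpE hpl hpσ htV' htl' htσ'
        exact ⟨p ++ t', h₁, h₂, h₃, List.mem_append_right p het⟩
      · obtain ⟨l, hlE, hll, hlσ, hel⟩ := hused e (Finset.mem_sdiff.mpr ⟨heE, heV⟩)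
        obtain ⟨h₁, h₂, h₃⟩ := append l t hlE hll hlσ htV htl htσ
        exact ⟨l ++ t, h₁, h₂, h₃, List.mem_append_left t hel⟩

theorem choose_le_four_pow_mul_choose {N h k : ℕ} (hN : N ≤ 2 * h) (hk : 2 * k ≤ h) :
    N.choose k ≤ 4 ^ k * h.choose k := by
  have hdesc : ∀ j ≤ k, N.descFactorial j ≤ 4 ^ j * h.descFactorial j := by
    intro j
    induction j with
    | zero => simp
    | succ j ih =>
      intro hj
      rw [Nat.descFactorial_succ, Nat.descFactorial_succ]
      calc (N - j) * N.descFactorial j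
          ≤ (4 * (h - j)) * (4 ^ j * h.descFactorial j) :=
            Nat.mul_le_mul (by omega) (ih (by omega))
        _ = 4 ^ (j + 1) * ((h - j) * h.descFactorial j) := by ring
  have := hdesc k le_rfl
  rw [Nat.descFactorial_eq_factorial_mul_choose, Nat.descFactorial_eq_factorial_mul_choose,
    mul_left_comm] at this
  exact Nat.le_of_mul_le_mul_left this k.factorial_pos

/-- Every two-coloring of a set of size `N ≥ 4 * k` makes at least a `4 ^ (-k)` fraction of the
`k`-subsets monochromatic. -/
theorem exists_monochromatic_family {N k : ℕ} (hk : 4 * k ≤ N) (χ : Fin N → Bool) :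
    ∃ M : Finset (Finset (Fin N)), N.choose k ≤ 4 ^ k * M.card ∧
      ∀ e ∈ M, e.card = k ∧ ∀ x ∈ e, ∀ y ∈ e, χ x = χ y := by
  obtain ⟨b, hb⟩ : ∃ b, N ≤ 2 * (Finset.univ.filter fun x => χ x = b).card := by
    by_contra! hcon
    have hsum := Finset.card_eq_sum_card_fiberwise (s := Finset.univ) (t := Finset.univ) (f := χ)
      fun _ _ => Finset.mem_coe.mpr (Finset.mem_univ _)
    rw [Fintype.sum_bool, Finset.card_univ, Fintype.card_fin] at hsum
    have := hcon true
    have := hcon false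
    omega
  refine ⟨(Finset.univ.filter fun x => χ x = b).powersetCard k, ?_, fun e he => ?_⟩
  · rw [Finset.card_powersetCard]
    exact choose_le_four_pow_mul_choose hb (by omega)
  · obtain ⟨hsub, hcard⟩ := Finset.mem_powersetCard.mp he
    refine ⟨hcard, fun x hx y hy => ?_⟩
    rw [(Finset.mem_filter.mp (hsub hx)).2, (Finset.mem_filter.mp (hsub hy)).2]

/-- **Theorem 1 (paper)**: there is an absolute constant `c > 0` such that any
deterministic one-pass streaming algorithm (modeled as a finite automaton with state
set `S`, initial state `σ₀`, transition `δ` and output `out`) that properly two-colors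
every streamed `n`-uniform hypergraph on `[n²]` with at most `q` hyperedges must
satisfy `log₂ |S| ≥ c·q/n`. -/
theorem deterministic_streaming_lower_bound :
    ∃ c : ℝ, 0 < c ∧
      ∀ (n q : ℕ), 100 ≤ n → 1 ≤ q →
      ∀ (S : Type) [Fintype S] (σ₀ : S)
        (δ : S → Finset (Fin (n ^ 2)) → S)
        (out : S → Fin (n ^ 2) → Bool),
        (∀ l : List (Finset (Fin (n ^ 2))),
          (∀ e ∈ l, e.card = n) → l.length ≤ q →
          ∀ e ∈ l.toFinset, ∃ x ∈ e, ∃ y ∈ e,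
            out (l.foldl δ σ₀) x ≠ out (l.foldl δ σ₀) y) →
        c * q / n ≤ Real.logb 2 (Fintype.card S) := by
  refine ⟨1 / 6, by norm_num, ?_⟩
  intro n q hn hq S _ σ₀ δ out hvalid
  have hn4 : 4 * n ≤ n ^ 2 := by nlinarith
  have hchoose : 0 < (n ^ 2).choose n := Nat.choose_pos (by omega)
  have hcard : 1 < Fintype.card S := by
    by_contra! hS
    have := Fintype.card_le_one_iff_subsingleton.mp hS
    obtain ⟨M, hM, hmono⟩ := exists_monochromatic_family hn4 (out σ₀)
    obtain ⟨e, he⟩ : M.Nonempty := by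
      rw [← Finset.card_pos]
      exact Nat.pos_of_mul_pos_left (hchoose.trans_le hM)
    obtain ⟨x, hx, y, hy, hxy⟩ := hvalid [e] (by simpa using (hmono e he).1) (by simpa using hq)
      e (by simp)
    rw [Subsingleton.elim (List.foldl δ σ₀ [e]) σ₀] at hxy
    exact hxy ((hmono e he).2 x hx y hy)
  have hlog : 1 ≤ Nat.log 2 (Fintype.card S) := Nat.log_pos one_lt_two hcard
  have hq_lt : q < (2 * n + 1) * (Nat.log 2 (Fintype.card S) + 1) := by
    by_contra! hlen
    obtain ⟨σ, V, -, hV, -, hused⟩ := exists_state_few_unused δ σ₀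
      (Finset.univ.powersetCard n) (Nat.log 2 (Fintype.card S) + 1)
      (Nat.lt_pow_succ_log_self one_lt_two _) (2 * n + 1)
    obtain ⟨M, hM, hmono⟩ := exists_monochromatic_family hn4 (out σ)
    have hMV : M ⊆ V := by
      intro e he
      by_contra heV
      obtain ⟨l, hlE, hll, hlσ, hel⟩ := hused e <| Finset.mem_sdiff.mpr
        ⟨Finset.mem_powersetCard.mpr ⟨Finset.subset_univ _, (hmono e he).1⟩, heV⟩
      obtain ⟨x, hx, y, hy, hxy⟩ := hvalid l
        (fun a ha => (Finset.mem_powersetCard.mp (hlE a ha)).2) (hll.trans hlen) e (by simpa using hel)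
      rw [hlσ] at hxy
      exact hxy ((hmono e he).2 x hx y hy)
    rw [Finset.card_powersetCard, Finset.card_univ, Fintype.card_fin, pow_succ, pow_mul] at hV
    have hle : 4 ^ n * M.card ≤ 4 ^ n * V.card :=
      Nat.mul_le_mul_left _ (Finset.card_le_card hMV)
    norm_num at hV
    linarith
  have hq_le : (q : ℝ) ≤ 6 * n * Nat.log 2 (Fintype.card S) := by
    have : q ≤ 6 * n * Nat.log 2 (Fintype.card S) := by nlinarith
    exact_mod_cast this
  have hlogb : (Nat.log 2 (Fintype.card S) : ℝ) ≤ Real.logb 2 (Fintype.card S) := by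
    exact_mod_cast Real.natLog_le_logb (Fintype.card S) 2
  refine le_trans ?_ hlogb
  rw [div_le_iff₀ (by positivity)]
  linarith
end

section
/- For every real constant c ≥ 1 there is an integer n₀ such that for all integers n ≥ n₀ and all integers v with n ≤ v ≤ n^c the following holds. Set q = ⌊2^{n/2}⌋, k = ⌈6 · 2^{n/2} · log₂ v⌉ and r = 2^n. There exist sets L_1, …, L_r, each consisting of at most k two-colorings of [v], such that: (a) for every n-uniform hypergraph H on [v] with at most q hyperedges and every i ∈ {1,…,r}, some coloring in L_i is valid for H; and (b) for every n-uniform hypergraph H on [v] with at most q hyperedges, there exists i ∈ {1,…,r} such that every coloring in L_i is valid for H. -/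
/-- If every bad set `B i` has density at most `p`, some `r` tuples of length `k` have the property
that no tuple lies entirely inside any bad set, while every bad set is avoided by some tuple. -/
theorem exists_tuples_of_density_le {I C : Type*} [Fintype I] [Fintype C] [Nonempty C]
    [DecidableEq C] (B : I → Finset C) (k r : ℕ) (p δ : ℝ) (hp1 : p ≤ 1)
    (hB : ∀ i, ((B i).card : ℝ) ≤ p * Fintype.card C) (hδ0 : 0 < δ)
    (hδ : δ ≤ (1 - p) ^ k - Fintype.card I * p ^ k)
    (hr : (Fintype.card I : ℝ) * (1 - δ) ^ r < 1) (hp0 : 0 ≤ p) :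
    ∃ f : Fin r → Fin k → C, (∀ i a, ∃ j, f a j ∉ B i) ∧ ∀ i, ∃ a, ∀ j, f a j ∉ B i := by
  classical
  set N : ℝ := (Fintype.card C : ℝ) with hN
  have hN0 : 0 < N := by rw [hN]; exact_mod_cast Fintype.card_pos
  let X : Finset (Fin k → C) := Finset.univ.biUnion fun i => Fintype.piFinset fun _ => B i
  let G : Finset (Fin k → C) := Xᶜ
  have hX : (X.card : ℝ) ≤ Fintype.card I * p ^ k * N ^ k := by
    have h1 : (X.card : ℝ) ≤ ∑ i : I, ((B i).card : ℝ) ^ k := by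
      have := Finset.card_biUnion_le (s := (Finset.univ : Finset I))
        (t := fun i => Fintype.piFinset fun _ : Fin k => B i)
      simp only [Fintype.card_piFinset, Finset.prod_const, Finset.card_univ, Fintype.card_fin]
        at this
      exact_mod_cast this
    refine h1.trans ?_
    calc ∑ i : I, ((B i).card : ℝ) ^ k ≤ ∑ _i : I, (p * N) ^ k :=
          Finset.sum_le_sum fun i _ => pow_le_pow_left₀ (by positivity) (hB i) k
      _ = _ := by simp [mul_pow, mul_assoc]
  have hGX : (G.card : ℝ) + X.card = N ^ k := by
    have := Finset.card_compl_add_card X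
    rw [Fintype.card_fun, Fintype.card_fin] at this
    rw [hN]; exact_mod_cast this
  have hG0 : 0 < (G.card : ℝ) := by
    have h1 : (1 - p) ^ k ≤ 1 := pow_le_one₀ (by linarith) (by linarith)
    have h2 : Fintype.card I * p ^ k * N ^ k < 1 * N ^ k :=
      mul_lt_mul_of_pos_right (by linarith) (by positivity)
    linarith
  have hGN : (G.card : ℝ) ≤ N ^ k := by
    have : (0 : ℝ) ≤ X.card := by positivity
    linarith
  let A : I → Finset (Fin k → C) := fun i => Fintype.piFinset fun _ => (B i)ᶜ
  have hA : ∀ i, ((1 - p) * N) ^ k ≤ ((A i).card : ℝ) := by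
    intro i
    have h1 : ((A i).card : ℝ) = (((B i)ᶜ.card : ℕ) : ℝ) ^ k := by
      simp [A, Fintype.card_piFinset]
    have h2 : (((B i)ᶜ.card : ℕ) : ℝ) + (B i).card = N := by
      rw [hN]; exact_mod_cast Finset.card_compl_add_card (B i)
    rw [h1]
    refine pow_le_pow_left₀ (mul_nonneg (by linarith) hN0.le) ?_ k
    linarith [hB i]
  have hGA : ∀ i, ((G \ A i).card : ℝ) ≤ (1 - δ) * G.card := by
    intro i
    have h1 : (G \ A i).card + (A i).card ≤ G.card + X.card := by
      have h : (G \ A i).card + (A i).card ≤ Fintype.card (Fin k → C) := by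
        rw [← Finset.card_union_of_disjoint Finset.sdiff_disjoint]
        exact Finset.card_le_univ _
      exact h.trans (Finset.card_compl_add_card X).ge
    have h2 : ((G \ A i).card : ℝ) + (A i).card ≤ G.card + X.card := by exact_mod_cast h1
    have h3 := hA i
    rw [mul_pow] at h3
    have h4 : δ * N ^ k ≤ ((1 - p) ^ k - Fintype.card I * p ^ k) * N ^ k :=
      mul_le_mul_of_nonneg_right hδ (by positivity)
    have h5 := mul_le_mul_of_nonneg_left hGN hδ0.le
    linarith
  let F : Finset (Fin r → Fin k → C) := Fintype.piFinset fun _ => G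
  let Y : Finset (Fin r → Fin k → C) :=
    Finset.univ.biUnion fun i => Fintype.piFinset fun _ => G \ A i
  have hYF : Y.card < F.card := by
    have h1 : (Y.card : ℝ) ≤ ∑ i : I, ((G \ A i).card : ℝ) ^ r := by
      have := Finset.card_biUnion_le (s := (Finset.univ : Finset I))
        (t := fun i => Fintype.piFinset fun _ : Fin r => G \ A i)
      simp only [Fintype.card_piFinset, Finset.prod_const, Finset.card_univ, Fintype.card_fin]
        at this
      exact_mod_cast this
    have h2 : ∑ i : I, ((G \ A i).card : ℝ) ^ r ≤ ∑ _i : I, ((1 - δ) * G.card) ^ r :=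
      Finset.sum_le_sum fun i _ => pow_le_pow_left₀ (by positivity) (hGA i) r
    have h3 : ∑ _i : I, ((1 - δ) * G.card) ^ r
        = Fintype.card I * (1 - δ) ^ r * (G.card : ℝ) ^ r := by
      simp [mul_pow, mul_assoc]
    have h4 : Fintype.card I * (1 - δ) ^ r * (G.card : ℝ) ^ r < 1 * (G.card : ℝ) ^ r :=
      mul_lt_mul_of_pos_right hr (by positivity)
    have h5 : (F.card : ℝ) = (G.card : ℝ) ^ r := by simp [F, Fintype.card_piFinset]
    have : (Y.card : ℝ) < F.card := by linarith
    exact_mod_cast this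
  obtain ⟨f, hfF, hfY⟩ := Finset.exists_mem_notMem_of_card_lt_card hYF
  have hfG : ∀ a, f a ∈ G := by simpa [F] using hfF
  refine ⟨f, fun i a => ?_, fun i => ?_⟩
  · by_contra! h
    exact Finset.mem_compl.1 (hfG a)
      (Finset.mem_biUnion.2 ⟨i, Finset.mem_univ i, Fintype.mem_piFinset.2 h⟩)
  · by_contra! h
    refine hfY (Finset.mem_biUnion.2 ⟨i, Finset.mem_univ i, Fintype.mem_piFinset.2 fun a => ?_⟩)
    refine Finset.mem_sdiff.2 ⟨hfG a, fun hA => ?_⟩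
    obtain ⟨j, hj⟩ := h a
    exact Finset.mem_compl.1 (Fintype.mem_piFinset.1 hA j) hj

theorem card_filter_forall_mem_eq {v : ℕ} (e : Finset (Fin v)) (b : Bool) :
    (Finset.univ.filter fun χ : Fin v → Bool => ∀ x ∈ e, χ x = b).card * 2 ^ e.card = 2 ^ v := by
  have h : (Finset.univ.filter fun χ : Fin v → Bool => ∀ x ∈ e, χ x = b)
      = Fintype.piFinset fun x => if x ∈ e then {b} else Finset.univ := by
    ext χ
    simp only [Finset.mem_filter, Finset.mem_univ, true_and, Fintype.mem_piFinset]
    refine forall_congr' fun x => ?_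
    by_cases hx : x ∈ e <;> simp [hx]
  have h2 : (Fintype.piFinset fun x => if x ∈ e then {b} else (Finset.univ : Finset Bool)).card
      = 2 ^ eᶜ.card := by
    rw [Fintype.card_piFinset, ← Finset.prod_const, ← Finset.prod_filter_mul_prod_filter_not
      Finset.univ (· ∈ e)]
    rw [Finset.prod_eq_one, one_mul]
    · refine Finset.prod_congr (by ext; simp) fun x hx => ?_
      simp_all
    · intro x hx
      simp_all
  rw [h, h2, ← pow_add, Finset.card_compl_add_card, Fintype.card_fin]

/-- The proportion of colorings making some edge of `φ` monochromatic is at most `q * 2 / 2 ^ n`. -/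
theorem card_filter_monochromatic_le {v n q : ℕ}
    (φ : Fin q → {e : Finset (Fin v) // e.card = n}) :
    (Finset.univ.filter fun χ : Fin v → Bool =>
      ∃ t, ∀ x ∈ (φ t).1, ∀ y ∈ (φ t).1, χ x = χ y).card * 2 ^ n ≤ q * 2 * 2 ^ v := by
  classical
  have hsub : (Finset.univ.filter fun χ : Fin v → Bool =>
      ∃ t, ∀ x ∈ (φ t).1, ∀ y ∈ (φ t).1, χ x = χ y) ⊆
      (Finset.univ : Finset (Fin q × Bool)).biUnion fun z =>
        Finset.univ.filter fun χ : Fin v → Bool => ∀ x ∈ (φ z.1).1, χ x = z.2 := by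
    intro χ hχ
    obtain ⟨t, ht⟩ := (Finset.mem_filter.1 hχ).2
    simp only [Finset.mem_biUnion, Finset.mem_univ, true_and, Finset.mem_filter]
    rcases (φ t).1.eq_empty_or_nonempty with h | ⟨x, hx⟩
    · exact ⟨(t, true), by simp [h]⟩
    · exact ⟨(t, χ x), fun y hy => ht y hy x hx⟩
  calc _ ≤ (∑ z : Fin q × Bool,
        (Finset.univ.filter fun χ : Fin v → Bool => ∀ x ∈ (φ z.1).1, χ x = z.2).card) * 2 ^ n :=
        Nat.mul_le_mul_right _ ((Finset.card_le_card hsub).trans Finset.card_biUnion_le)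
    _ = ∑ z : Fin q × Bool, 2 ^ v := by
        rw [Finset.sum_mul]
        refine Finset.sum_congr rfl fun z _ => ?_
        have := card_filter_forall_mem_eq (φ z.1).1 z.2
        rwa [(φ z.1).2] at this
    _ = q * 2 * 2 ^ v := by simp

theorem exists_fin_subset_range {α : Type*} [Nonempty α] (E : Finset α) {q : ℕ}
    (h : E.card ≤ q) : ∃ φ : Fin q → α, ∀ e ∈ E, ∃ t, φ t = e := by
  classical
  let g : E → Fin q := fun e => Fin.castLE h (E.equivFin e)
  have hg : Function.Injective g := (Fin.castLE_injective h).comp E.equivFin.injective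
  refine ⟨Function.extend g Subtype.val fun _ => Classical.arbitrary α, fun e he => ?_⟩
  exact ⟨g ⟨e, he⟩, hg.extend_apply _ _ _⟩

theorem exp_neg_two_mul_le_one_sub {p : ℝ} (h0 : 0 ≤ p) (h : p ≤ 1 / 2) :
    Real.exp (-(2 * p)) ≤ 1 - p := by
  have h1 : 1 + 2 * p ≤ Real.exp (2 * p) := by linarith [Real.add_one_le_exp (2 * p)]
  rw [Real.exp_neg]
  refine (inv_anti₀ (by linarith) h1).trans ?_
  rw [inv_le_iff_one_le_mul₀ (by linarith)]
  nlinarith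

/-- The numerical estimates: with `s = 2 ^ (n / 2)` and `p = 2 / s`, both failure probabilities
are small, where `y` is the logarithm of the number of vertices. -/
theorem list_parameters_estimate {n k : ℕ} {s y M : ℝ} (hn : 100 ≤ n)
    (hs : s = Real.exp (n * Real.log 2 / 2)) (hy : 1 ≤ y) (hM : M ≤ Real.exp (n * s * y))
    (hk : 6 * s * (y / Real.log 2) ≤ k) (hk' : (k : ℝ) ≤ 6 * s * (y / Real.log 2) + 1)
    (hlarge : 2 * n * Real.exp (41 * y) < s) :
    Real.exp (-(40 * y)) / 2 ≤ (1 - 2 / s) ^ k - M * (2 / s) ^ k ∧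
      M * (1 - Real.exp (-(40 * y)) / 2) ^ (2 ^ n) < 1 := by
  have hn' : (100 : ℝ) ≤ n := by exact_mod_cast hn
  have hl1 := Real.log_two_gt_d9
  have hl2 := Real.log_two_lt_d9
  have hs4 : 4 ≤ s := by
    rw [hs]
    nlinarith [Real.add_one_le_exp (n * Real.log 2 / 2)]
  have hs0 : 0 < s := by linarith
  have hp0 : 0 ≤ 2 / s := by positivity
  have hp : 2 / s ≤ 1 / 2 := by rw [div_le_iff₀ hs0]; linarith
  have hpexp : 2 / s ≤ Real.exp (-(n / 4)) := by
    have h2 : (2 : ℝ) = Real.exp (Real.log 2) := (Real.exp_log two_pos).symm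
    have : 2 / s = Real.exp (Real.log 2 - n * Real.log 2 / 2) := by
      rw [Real.exp_sub, ← hs, ← h2]
    rw [this, Real.exp_le_exp]
    nlinarith
  have hsy : 4 ≤ s * y := by nlinarith
  have hyl : y ≤ y / Real.log 2 := by
    rw [le_div_iff₀ (by linarith)]; nlinarith
  have hyl' : y / Real.log 2 ≤ 1.45 * y := by
    rw [div_le_iff₀ (by linarith)]; nlinarith
  have hk1 : 6 * (s * y) ≤ k := by
    have := mul_le_mul_of_nonneg_left hyl hs0.le
    linarith
  have hk2 : (k : ℝ) ≤ 10 * (s * y) := by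
    have := mul_le_mul_of_nonneg_left hyl' hs0.le
    linarith
  have hMp : M * (2 / s) ^ k ≤ Real.exp (-(n * (s * y) / 2)) := by
    have h1 : (2 / s) ^ k ≤ Real.exp (-(n / 4) * (6 * (s * y))) := by
      refine (pow_le_pow_left₀ hp0 hpexp k).trans ?_
      rw [← Real.exp_nat_mul, Real.exp_le_exp]
      nlinarith
    calc M * (2 / s) ^ k ≤ Real.exp (n * s * y) * Real.exp (-(n / 4) * (6 * (s * y))) :=
          mul_le_mul hM h1 (by positivity) (Real.exp_pos _).le
      _ = _ := by rw [← Real.exp_add]; ring_nf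
  have hsmall : Real.exp (-(n * (s * y) / 2)) ≤ Real.exp (-(40 * y)) / 2 := by
    rw [le_div_iff₀ two_pos]
    have h2 : (2 : ℝ) ≤ Real.exp 1 := by linarith [Real.add_one_le_exp (1 : ℝ)]
    calc Real.exp (-(n * (s * y) / 2)) * 2 ≤ Real.exp (-(n * (s * y) / 2)) * Real.exp 1 :=
          mul_le_mul_of_nonneg_left h2 (Real.exp_pos _).le
      _ ≤ _ := by
          rw [← Real.exp_add, Real.exp_le_exp]
          have : 100 * (s * y) ≤ n * (s * y) := mul_le_mul_of_nonneg_right hn' (by linarith)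
          nlinarith
  have hvalid : Real.exp (-(40 * y)) ≤ (1 - 2 / s) ^ k := by
    refine le_trans ?_ (pow_le_pow_left₀ (Real.exp_pos _).le (exp_neg_two_mul_le_one_sub hp0 hp) k)
    rw [← Real.exp_nat_mul, Real.exp_le_exp]
    have h1 : (k : ℝ) * (2 / s) ≤ 10 * (s * y) * (2 / s) := mul_le_mul_of_nonneg_right hk2 hp0
    have h2 : 10 * (s * y) * (2 / s) = 20 * y := by field_simp; ring
    linarith
  refine ⟨by linarith, ?_⟩
  set δ := Real.exp (-(40 * y)) / 2 with hδ
  have hδ1 : δ ≤ 1 := by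
    have : Real.exp (-(40 * y)) ≤ 1 := Real.exp_le_one_iff.2 (by linarith)
    linarith
  have hpow : (1 - δ) ^ (2 ^ n) ≤ Real.exp (-(s * s * δ)) := by
    have h1 : ((2 ^ n : ℕ) : ℝ) = s * s := by
      rw [hs, ← Real.exp_add, add_halves, Real.exp_nat_mul, Real.exp_log two_pos]
      push_cast; rfl
    refine (pow_le_pow_left₀ (by linarith) (Real.one_sub_le_exp_neg δ) _).trans ?_
    rw [← Real.exp_nat_mul, h1, Real.exp_le_exp]
    linarith
  have hkey : n * y < s * δ := by
    have h1 : y ≤ Real.exp y := by linarith [Real.add_one_le_exp y]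
    have h2 : Real.exp (41 * y) = Real.exp y * Real.exp (40 * y) := by
      rw [← Real.exp_add]; ring_nf
    rw [hδ, Real.exp_neg, mul_div_assoc', lt_div_iff₀ two_pos, ← div_eq_mul_inv,
      lt_div_iff₀ (Real.exp_pos _)]
    refine lt_of_le_of_lt ?_ hlarge
    rw [h2]
    have := mul_le_mul_of_nonneg_right h1 (Real.exp_pos (40 * y)).le
    nlinarith
  calc M * (1 - δ) ^ (2 ^ n) ≤ Real.exp (n * s * y) * Real.exp (-(s * s * δ)) :=
        mul_le_mul hM hpow (pow_nonneg (by linarith) _) (Real.exp_pos _).le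
    _ = Real.exp (s * (n * y - s * δ)) := by rw [← Real.exp_add]; ring_nf
    _ < 1 := Real.exp_lt_one_iff.2 (mul_neg_of_pos_of_neg hs0 (by linarith))

theorem eventually_mul_exp_log_lt (c : ℝ) (hc : 1 ≤ c) :
    ∃ n₀ : ℕ, ∀ n : ℕ, n₀ ≤ n → ∀ y : ℝ, y ≤ c * Real.log n →
      2 * n * Real.exp (41 * y) < Real.exp (n * Real.log 2 / 2) := by
  have h := (Real.isLittleO_log_id_atTop.comp_tendsto tendsto_natCast_atTop_atTop).bound
    (show 0 < 1 / (3 * (41 * c + 2)) by positivity)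
  obtain ⟨n₁, hn₁⟩ := Filter.eventually_atTop.1 h
  refine ⟨max n₁ 2, fun n hn y hy => ?_⟩
  have hn2 : (2 : ℝ) ≤ n := by exact_mod_cast (le_max_right _ _).trans hn
  have hb := hn₁ n ((le_max_left _ _).trans hn)
  simp only [Function.comp_apply, id, Real.norm_eq_abs, Nat.abs_cast] at hb
  have hlog := (le_abs_self _).trans hb
  rw [one_div_mul_eq_div, le_div_iff₀ (by positivity)] at hlog
  have hl1 := Real.log_two_gt_d9
  have hl2 : Real.log 2 ≤ Real.log n := Real.log_le_log two_pos hn2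
  have h2n : 2 * (n : ℝ) = Real.exp (Real.log 2 + Real.log n) := by
    rw [Real.exp_add, Real.exp_log two_pos, Real.exp_log (by linarith)]
  rw [h2n, ← Real.exp_add, Real.exp_lt_exp]
  nlinarith

/-- **Lemma 1 (paper)**: for any constant `c ≥ 1` and all large `n`, and any
`n ≤ v ≤ n^c`, there exist `r = 2^n` lists of two-colorings of `[v]`, each of size at
most `k = ⌈6·2^(n/2)·log₂ v⌉`, which are simultaneously good for Bob (every list
contains a valid coloring for every hypergraph with at most `⌊2^(n/2)⌋` hyperedges)
and good for Alice (for every such hypergraph some list consists entirely of valid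
colorings). -/
theorem good_lists_exist :
    ∀ c : ℝ, 1 ≤ c → ∃ n₀ : ℕ, ∀ n : ℕ, n₀ ≤ n → ∀ v : ℕ, n ≤ v → (v : ℝ) ≤ (n : ℝ) ^ c →
    ∃ L : Fin (2 ^ n) → Finset (Fin v → Bool),
      (∀ i, (L i).card ≤ ⌈6 * (2 : ℝ) ^ ((n : ℝ) / 2) * Real.logb 2 v⌉₊) ∧
      (∀ E : Finset (Finset (Fin v)), (∀ e ∈ E, e.card = n) →
        E.card ≤ ⌊(2 : ℝ) ^ ((n : ℝ) / 2)⌋₊ →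
        (∀ i, ∃ χ ∈ L i, ∀ e ∈ E, ∃ x ∈ e, ∃ y ∈ e, χ x ≠ χ y) ∧
        (∃ i, ∀ χ ∈ L i, ∀ e ∈ E, ∃ x ∈ e, ∃ y ∈ e, χ x ≠ χ y)) := by
  classical
  intro c hc
  obtain ⟨n₁, hn₁⟩ := eventually_mul_exp_log_lt c hc
  refine ⟨max n₁ 100, fun n hn v hnv hvc => ?_⟩
  have hn100 : 100 ≤ n := (le_max_right _ _).trans hn
  have hn0 : (100 : ℝ) ≤ n := by exact_mod_cast hn100
  have hv0 : (100 : ℝ) ≤ v := by exact_mod_cast hn100.trans hnv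
  have hvpos : (0 : ℝ) < v := by linarith
  set s : ℝ := (2 : ℝ) ^ ((n : ℝ) / 2) with hs
  set k : ℕ := ⌈6 * s * Real.logb 2 v⌉₊ with hk
  set y : ℝ := Real.log v with hy
  have hsexp : s = Real.exp (n * Real.log 2 / 2) := by
    rw [hs, Real.rpow_def_of_pos two_pos]; ring_nf
  have hs0 : 0 < s := by rw [hsexp]; exact Real.exp_pos _
  have hss : s * s = 2 ^ n := by
    rw [hs, ← Real.rpow_add two_pos, add_halves, Real.rpow_natCast]
  have hy1 : 1 ≤ y := by
    rw [hy, Real.le_log_iff_exp_le hvpos]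
    linarith [Real.exp_one_lt_d9]
  have hyc : y ≤ c * Real.log n := by
    rw [← Real.log_rpow (by linarith)]
    exact Real.log_le_log hvpos hvc
  have hlarge := hn₁ n ((le_max_left _ _).trans hn) y hyc
  rw [← hsexp] at hlarge
  have hl : 0 < Real.log 2 := Real.log_pos one_lt_two
  have hk1 : 6 * s * (y / Real.log 2) ≤ k := Nat.le_ceil _
  have hk2 : (k : ℝ) ≤ 6 * s * (y / Real.log 2) + 1 :=
    (Nat.ceil_lt_add_one (mul_nonneg (by positivity) (div_nonneg (by linarith) hl.le))).le
  let S := {e : Finset (Fin v) // e.card = n}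
  have : Nonempty S := by
    obtain ⟨e, -, he⟩ := Finset.exists_subset_card_eq
      (s := (Finset.univ : Finset (Fin v))) (n := n) (by simpa using hnv)
    exact ⟨⟨e, he⟩⟩
  have hq : ((⌊s⌋₊ : ℕ) : ℝ) ≤ s := Nat.floor_le hs0.le
  have hM : (Fintype.card (Fin ⌊s⌋₊ → S) : ℝ) ≤ Real.exp (n * s * y) := by
    have h1 : Fintype.card S ≤ v ^ n := by
      rw [Fintype.card_finset_len, Fintype.card_fin]
      exact Nat.choose_le_pow v n
    have h2 : (Fintype.card S : ℝ) ≤ Real.exp (n * y) := by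
      rw [Real.exp_nat_mul, hy, Real.exp_log hvpos]
      exact_mod_cast h1
    rw [Fintype.card_fun, Fintype.card_fin, Nat.cast_pow]
    refine (pow_le_pow_left₀ (by positivity) h2 _).trans ?_
    rw [← Real.exp_nat_mul, Real.exp_le_exp]
    have : 0 ≤ n * y := by positivity
    nlinarith
  obtain ⟨hδ, hr⟩ := list_parameters_estimate hn100 hsexp hy1 hM hk1 hk2 hlarge
  have hs2 : 2 ≤ s := by
    have := Real.one_le_exp (show 0 ≤ 41 * y by linarith)
    nlinarith
  obtain ⟨f, hBob, hAlice⟩ := exists_tuples_of_density_le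
    (fun φ : Fin ⌊s⌋₊ → S => Finset.univ.filter fun χ : Fin v → Bool =>
      ∃ t, ∀ x ∈ (φ t).1, ∀ y ∈ (φ t).1, χ x = χ y)
    k (2 ^ n) (2 / s) (Real.exp (-(40 * y)) / 2) ((div_le_one hs0).2 hs2)
    (fun φ => by
      have h : ((Finset.univ.filter fun χ : Fin v → Bool =>
          ∃ t, ∀ x ∈ (φ t).1, ∀ y ∈ (φ t).1, χ x = χ y).card : ℝ) * 2 ^ n
            ≤ (⌊s⌋₊ : ℕ) * 2 * 2 ^ v := by
        exact_mod_cast card_filter_monochromatic_le φ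
      have hC : (Fintype.card (Fin v → Bool) : ℝ) = 2 ^ v := by simp
      rw [hC]
      rw [← hss] at h
      rw [div_mul_eq_mul_div, le_div_iff₀ hs0]
      have h2 : (⌊s⌋₊ : ℕ) * 2 * (2 : ℝ) ^ v ≤ s * 2 * 2 ^ v := by gcongr
      refine le_of_mul_le_mul_right ?_ hs0
      linarith)
    (by positivity) hδ hr (by positivity)
  refine ⟨fun i => Finset.univ.image (f i), fun i => ?_, fun E hE hEq => ?_⟩
  · simpa using Finset.card_image_le (s := Finset.univ) (f := f i)
  · obtain ⟨φ, hφ⟩ := exists_fin_subset_range (E.subtype fun e => e.card = n)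
      (q := ⌊s⌋₊) ((Finset.card_subtype _ _).trans_le ((Finset.card_filter_le _ _).trans hEq))
    have hvalid : ∀ χ : Fin v → Bool,
        χ ∉ (Finset.univ.filter fun χ : Fin v → Bool =>
          ∃ t, ∀ x ∈ (φ t).1, ∀ y ∈ (φ t).1, χ x = χ y) →
        ∀ e ∈ E, ∃ x ∈ e, ∃ y ∈ e, χ x ≠ χ y := by
      intro χ hχ e he
      obtain ⟨t, ht⟩ := hφ ⟨e, hE e he⟩ (Finset.mem_subtype.2 he)
      by_contra! h
      exact hχ (Finset.mem_filter.2 ⟨Finset.mem_univ _, t, by rw [ht]; exact h⟩)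
    refine ⟨fun i => ?_, ?_⟩
    · obtain ⟨j, hj⟩ := hBob φ i
      exact ⟨f i j, Finset.mem_image_of_mem _ (Finset.mem_univ j), hvalid _ hj⟩
    · obtain ⟨i, hi⟩ := hAlice φ
      refine ⟨i, fun χ hχ => ?_⟩
      obtain ⟨j, -, rfl⟩ := Finset.mem_image.1 hχ
      exact hvalid _ (hi j)
end
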